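/- arXiv:1805.04341 — 2 statements merged into one kernel-verified Lean document; each statement's English description precedes it below -/
import Mathlib

section
/- For all integers n ≥ 2, we have |log v(n) − γ·n²| ≤ 4n, where v(n) := max_{w ∈ 𝓛_n} Υ_w, γ := f(α)/(1−α²), and α is the unique solution in (0,1) of 2x·f(x) + (1−x²)·f′(x) = 0. -/
/-- The simple transposition `sᵢ = (i, i+1)` acting on `ℕ` (positions are 1-indexed,
so a permutation of `{1,…,n}` is modeled as a permutation of `ℕ` fixing `0` and all `i > n`). -/
def sT (i : ℕ) : Equiv.Perm ℕ := Equiv.swap i (i + 1)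

/-- The number of inversions `ℓ(w)` of `w` on `{1,…,n}`. -/
def len (n : ℕ) (w : Equiv.Perm ℕ) : ℕ :=
  ((Finset.Icc 1 n ×ˢ Finset.Icc 1 n).filter
    (fun p => p.1 < p.2 ∧ w p.2 < w p.1)).card

open scoped Classical in
/-- Macdonald's identity form of the principal specialization `𝔖_w(1,…,1)` of the
Schubert polynomial: `Υ_w = (1/ℓ!) ⬝ Σ_{(a₁,…,a_ℓ) ∈ R(w)} a₁ a₂ ⋯ a_ℓ`, where the sum is
over reduced words of `w`, i.e. tuples with `1 ≤ aᵢ ≤ n − 1` and `w = s_{a₁} ⋯ s_{a_ℓ}`. -/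
noncomputable def Upsilon (n : ℕ) (w : Equiv.Perm ℕ) : ℚ :=
  ((len n w).factorial : ℚ)⁻¹ *
    ∑ a ∈ Finset.univ.filter (fun a : Fin (len n w) → Fin n =>
        (∀ i, 1 ≤ (a i : ℕ)) ∧ (List.ofFn fun i => sT ((a i : ℕ))).prod = w),
      ∏ i, ((a i : ℕ) : ℚ)

/-- Reversal of the block of positions `s+1, …, s+c`, as a permutation of `ℕ`. -/
def blockRev (s c : ℕ) : Equiv.Perm ℕ :=
  ((List.range (c / 2)).map fun i => Equiv.swap (s + i + 1) (s + c - i)).prod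

/-- The layered permutation `w(b_k, …, b_1)` whose blocks, read left to right,
are given by the list `b = [b_k, …, b_1]`: it reverses the consecutive blocks of
positions of sizes `b_k, b_{k−1}, …, b_1`. -/
def layeredPerm (b : List ℕ) : Equiv.Perm ℕ :=
  ((List.range b.length).map fun j => blockRev ((b.take j).sum) (b.getD j 0)).prod

/-- `𝓛ₙ`: the set of layered permutations in `S_n`. -/
def LayeredSet (n : ℕ) : Set (Equiv.Perm ℕ) :=
  {w | ∃ b : List ℕ, (∀ c ∈ b, 0 < c) ∧ b.sum = n ∧ w = layeredPerm b}

/-- `v(n) = max_{w ∈ 𝓛ₙ} Υ_w` (as a real number; the set is finite and nonempty,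
so the supremum is attained). -/
noncomputable def v (n : ℕ) : ℝ :=
  sSup ((fun w => ((Upsilon n w : ℚ) : ℝ)) '' LayeredSet n)

/-- The function `f(x) = x² log x − ½(1−x)² log(1−x) − ½(1+x)² log(1+x) + 2x log 2`
(natural logarithms; `Real.log 0 = 0` gives the continuous extension `f 0 = f 1 = 0`). -/
noncomputable def f (x : ℝ) : ℝ :=
  x ^ 2 * Real.log x - (1 / 2) * (1 - x) ^ 2 * Real.log (1 - x)
    - (1 / 2) * (1 + x) ^ 2 * Real.log (1 + x) + 2 * x * Real.log 2

theorem sT_mul_sT (i : ℕ) : sT i * sT i = 1 := Equiv.swap_mul_self _ _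

theorem mul_sT_mul_sT (w : Equiv.Perm ℕ) (i : ℕ) : w * sT i * sT i = w := by
  rw [mul_assoc, sT_mul_sT, mul_one]

theorem sT_apply_left (i : ℕ) : sT i i = i + 1 := Equiv.swap_apply_left _ _

theorem sT_apply_right (i : ℕ) : sT i (i + 1) = i := Equiv.swap_apply_right _ _

theorem sT_apply_of_ne {i p : ℕ} (h : p ≠ i) (h' : p ≠ i + 1) : sT i p = p :=
  Equiv.swap_apply_of_ne_of_ne h h'

theorem sT_apply (i p : ℕ) : sT i p = if p = i then i + 1 else if p = i + 1 then i else p :=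
  Equiv.swap_apply_def _ _ _

/-- The set of inversions counted by `len`. -/
def inversions (n : ℕ) (w : Equiv.Perm ℕ) : Finset (ℕ × ℕ) :=
  (Finset.Icc 1 n ×ˢ Finset.Icc 1 n).filter (fun p => p.1 < p.2 ∧ w p.2 < w p.1)

theorem len_eq_card (n : ℕ) (w : Equiv.Perm ℕ) : len n w = (inversions n w).card := rfl

theorem mem_inversions {n : ℕ} {w : Equiv.Perm ℕ} {p q : ℕ} :
    (p, q) ∈ inversions n w ↔ 1 ≤ p ∧ q ≤ n ∧ p < q ∧ w q < w p := by
  unfold inversions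
  rw [Finset.mem_filter, Finset.mem_product, Finset.mem_Icc, Finset.mem_Icc]
  constructor <;> intro h <;> simp only at h ⊢ <;> omega

/-- Multiplying on the right by `sT i` at an ascent adds exactly one inversion. -/
theorem len_mul_sT_of_lt {n i : ℕ} {w : Equiv.Perm ℕ} (hi : 1 ≤ i) (hin : i < n)
    (h : w i < w (i + 1)) : len n (w * sT i) = len n w + 1 := by
  classical
  have hmem : (i, i + 1) ∉ inversions n w := by
    rw [mem_inversions]
    omega
  have e : ∀ x, sT i (sT i x) = x := fun x => Equiv.swap_apply_self _ _ x
  have key : ∀ p q : ℕ, ¬ (p = i ∧ q = i + 1) → 1 ≤ p → p < q → q ≤ n →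
      (sT i p < sT i q ∧ 1 ≤ sT i p ∧ sT i q ≤ n) := by
    intro p q hne hp hpq hq
    rw [sT_apply, sT_apply]
    split_ifs <;> omega
  have inv : ∀ p q : ℕ, (p, q) ≠ (i, i + 1) → p < q → (sT i p, sT i q) ≠ (i, i + 1) := by
    intro p q _ hlt h3
    simp only [Prod.mk.injEq] at h3
    have h4 : p = i + 1 := by rw [← e p, h3.1, sT_apply_left]
    have h5 : q = i := by rw [← e q, h3.2, sT_apply_right]
    omega
  rw [len_eq_card, len_eq_card, ← Finset.card_insert_of_notMem hmem]
  have lt_of_mem : ∀ p q, (p, q) ∈ insert (i, i + 1) (inversions n w) → p < q := by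
    intro p q hp
    rw [Finset.mem_insert, mem_inversions, Prod.mk.injEq] at hp
    omega
  refine Finset.card_bij' (fun p _ => if p = (i, i + 1) then p else (sT i p.1, sT i p.2))
    (fun p _ => if p = (i, i + 1) then p else (sT i p.1, sT i p.2)) ?_ ?_ ?_ ?_
  · rintro ⟨p, q⟩ hp
    rw [mem_inversions, Equiv.Perm.mul_apply, Equiv.Perm.mul_apply] at hp
    by_cases hpq : (p, q) = (i, i + 1)
    · simp only [hpq, if_true]
      exact Finset.mem_insert_self _ _
    · rw [if_neg hpq]
      refine Finset.mem_insert_of_mem ?_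
      rw [mem_inversions]
      have := key p q (by simpa using hpq) hp.1 hp.2.2.1 hp.2.1
      exact ⟨this.2.1, this.2.2, this.1, hp.2.2.2⟩
  · rintro ⟨p, q⟩ hp
    rw [Finset.mem_insert] at hp
    by_cases hpq : (p, q) = (i, i + 1)
    · simp only [hpq, if_true]
      rw [mem_inversions, Equiv.Perm.mul_apply, Equiv.Perm.mul_apply, sT_apply_left,
        sT_apply_right]
      omega
    · rw [if_neg hpq]
      have hp := hp.resolve_left hpq
      rw [mem_inversions] at hp
      have := key p q (by simpa using hpq) hp.1 hp.2.2.1 hp.2.1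
      rw [mem_inversions, Equiv.Perm.mul_apply, Equiv.Perm.mul_apply, e, e]
      exact ⟨this.2.1, this.2.2, this.1, hp.2.2.2⟩
  · rintro ⟨p, q⟩ hp
    rw [mem_inversions] at hp
    by_cases hpq : (p, q) = (i, i + 1)
    · simp [hpq]
    · have h2 := inv p q hpq hp.2.2.1
      simp only [hpq, if_false, h2, e]
  · rintro ⟨p, q⟩ hp
    by_cases hpq : (p, q) = (i, i + 1)
    · simp [hpq]
    · have h2 := inv p q hpq (lt_of_mem p q hp)
      simp only [hpq, if_false, h2, e]

theorem len_mul_sT_of_gt {n i : ℕ} {w : Equiv.Perm ℕ} (hi : 1 ≤ i) (hin : i < n)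
    (h : w (i + 1) < w i) : len n (w * sT i) + 1 = len n w := by
  have h' : (w * sT i) i < (w * sT i) (i + 1) := by
    simpa [sT_apply_left, sT_apply_right] using h
  have := len_mul_sT_of_lt hi hin h'
  rw [mul_sT_mul_sT] at this
  exact this.symm

theorem len_one (n : ℕ) : len n 1 = 0 := by
  rw [len_eq_card, Finset.card_eq_zero, Finset.eq_empty_iff_forall_notMem]
  rintro ⟨p, q⟩ h
  rw [mem_inversions, Equiv.Perm.one_apply, Equiv.Perm.one_apply] at h
  omega

/-- The weighted number of words of length `k` in the simple transpositions with product `w`. -/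
noncomputable def wordSum (n k : ℕ) (w : Equiv.Perm ℕ) : ℚ :=
  open scoped Classical in
  ∑ a ∈ Finset.univ.filter (fun a : Fin k → Fin n =>
        (∀ i, 1 ≤ (a i : ℕ)) ∧ (List.ofFn fun i => sT ((a i : ℕ))).prod = w),
      ∏ i, ((a i : ℕ) : ℚ)

theorem wordSum_zero_one (n : ℕ) : wordSum n 0 1 = 1 := by
  classical
  simp [wordSum]

theorem wordSum_succ (n k : ℕ) (w : Equiv.Perm ℕ) :
    wordSum n (k + 1) w = ∑ i ∈ Finset.Ico 1 n, (i : ℚ) * wordSum n k (w * sT i) := by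
  classical
  have h1 : ∑ i ∈ Finset.Ico 1 n, (i : ℚ) * wordSum n k (w * sT i)
      = ∑ i : Fin n, (i : ℚ) * wordSum n k (w * sT i) := by
    rw [Fin.sum_univ_eq_sum_range (fun i => (i : ℚ) * wordSum n k (w * sT i)) n,
      Finset.range_eq_Ico]
    rcases Nat.eq_zero_or_pos n with rfl | hn
    · simp
    · rw [Finset.sum_eq_sum_Ico_succ_bot hn]
      simp
  rw [h1]
  unfold wordSum
  simp_rw [Finset.sum_filter, Finset.mul_sum]
  rw [← Fintype.sum_prod_type', ← (Fin.snocEquiv (fun _ : Fin (k + 1) => Fin n)).sum_comp]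
  refine Finset.sum_congr rfl ?_
  rintro ⟨i, a⟩ -
  simp only [Fin.snocEquiv, Equiv.coe_fn_mk, Fin.prod_univ_castSucc, Fin.snoc_castSucc,
    Fin.snoc_last, List.ofFn_succ', List.prod_concat, Fin.forall_fin_succ']
  rcases Nat.eq_zero_or_pos (i : ℕ) with hi | hi
  · simp [hi]
  · have e : ∀ x : Equiv.Perm ℕ, x * sT i = w ↔ x = w * sT i := by
      intro x
      constructor
      · rintro rfl
        rw [mul_sT_mul_sT]
      · rintro rfl
        rw [mul_sT_mul_sT]
    have hi' : 1 ≤ (i : ℕ) := hi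
    simp only [hi', and_true, e, mul_comm (i : ℚ)]
    split_ifs <;> simp

theorem wordSum_eq_zero_of_lt {n k : ℕ} {w : Equiv.Perm ℕ} (h : k < len n w) :
    wordSum n k w = 0 := by
  classical
  induction k generalizing w with
  | zero =>
    unfold wordSum
    refine Finset.sum_eq_zero ?_
    intro a ha
    simp only [Finset.mem_filter] at ha
    have : w = 1 := by simpa using ha.2.2.symm
    rw [this, len_one] at h
    omega
  | succ k ih =>
    rw [wordSum_succ]
    refine Finset.sum_eq_zero ?_
    intro i hi
    rw [Finset.mem_Ico] at hi
    rw [ih, mul_zero]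
    rcases lt_trichotomy (w i) (w (i + 1)) with h1 | h1 | h1
    · have := len_mul_sT_of_lt hi.1 hi.2 h1
      omega
    · have := w.injective h1
      omega
    · have := len_mul_sT_of_gt hi.1 hi.2 h1
      omega

theorem Upsilon_eq (n : ℕ) (w : Equiv.Perm ℕ) :
    Upsilon n w = ((len n w).factorial : ℚ)⁻¹ * wordSum n (len n w) w := rfl

theorem Upsilon_one (n : ℕ) : Upsilon n 1 = 1 := by
  rw [Upsilon_eq, len_one, wordSum_zero_one]
  simp

theorem len_mul_Upsilon (n : ℕ) (w : Equiv.Perm ℕ) (h0 : len n w ≠ 0) :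
    (len n w : ℚ) * Upsilon n w =
      ∑ i ∈ (Finset.Ico 1 n).filter (fun i => w (i + 1) < w i), (i : ℚ) * Upsilon n (w * sT i) := by
  obtain ⟨k, hk⟩ := Nat.exists_eq_succ_of_ne_zero h0
  rw [Nat.succ_eq_add_one] at hk
  have h1 : (len n w : ℚ) * Upsilon n w = ((k.factorial : ℕ) : ℚ)⁻¹ * wordSum n (k + 1) w := by
    rw [Upsilon_eq, hk, Nat.factorial_succ]
    push_cast
    have : (k : ℚ) + 1 ≠ 0 := by positivity
    have : ((k.factorial : ℕ) : ℚ) ≠ 0 := by positivity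
    field_simp
  rw [h1, wordSum_succ, Finset.mul_sum, Finset.sum_filter]
  refine Finset.sum_congr rfl ?_
  intro i hi
  rw [Finset.mem_Ico] at hi
  split_ifs with h
  · have := len_mul_sT_of_gt hi.1 hi.2 h
    rw [Upsilon_eq, show len n (w * sT i) = k by omega]
    ring
  · rw [wordSum_eq_zero_of_lt]
    · simp
    have h2 : w i ≠ w (i + 1) := fun h3 => by
      have := w.injective h3
      omega
    rw [len_mul_sT_of_lt hi.1 hi.2 (by omega)]
    omega

open MvPolynomial in
theorem exists_mul_eq_sub_rename (p : ℕ) (g : MvPolynomial ℕ ℚ) :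
    ∃ q, (X p - X (p + 1)) * q = g - rename (sT p) g := by
  induction g using MvPolynomial.induction_on with
  | C a => exact ⟨0, by simp⟩
  | add g h hg hh =>
    obtain ⟨a, ha⟩ := hg
    obtain ⟨b, hb⟩ := hh
    refine ⟨a + b, ?_⟩
    rw [mul_add, ha, hb, map_add]
    ring
  | mul_X g i hg =>
    obtain ⟨a, ha⟩ := hg
    have h : ∃ b : MvPolynomial ℕ ℚ, (X p - X (p + 1)) * b = X i - X (sT p i) := by
      rw [sT_apply]
      split_ifs with h1 h2
      · exact ⟨1, by rw [h1, mul_one]⟩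
      · exact ⟨-1, by rw [h2]; ring⟩
      · exact ⟨0, by ring⟩
    obtain ⟨b, hb⟩ := h
    refine ⟨a * X i + rename (sT p) g * b, ?_⟩
    rw [map_mul, rename_X]
    linear_combination X i * ha + rename (sT p) g * hb

open MvPolynomial in
theorem X_sub_X_ne_zero (p : ℕ) : (X p - X (p + 1) : MvPolynomial ℕ ℚ) ≠ 0 := by
  rw [sub_ne_zero]
  intro h
  have := MvPolynomial.X_injective h
  omega

open MvPolynomial in
/-- The divided difference operator `g ↦ (g - sₚ g) / (xₚ - xₚ₊₁)`. -/
noncomputable def divDiff (p : ℕ) : MvPolynomial ℕ ℚ →ₗ[ℚ] MvPolynomial ℕ ℚ where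
  toFun g := (exists_mul_eq_sub_rename p g).choose
  map_add' g h := by
    refine mul_left_cancel₀ (X_sub_X_ne_zero p) ?_
    rw [mul_add, (exists_mul_eq_sub_rename p g).choose_spec,
      (exists_mul_eq_sub_rename p h).choose_spec,
      (exists_mul_eq_sub_rename p (g + h)).choose_spec, map_add]
    ring
  map_smul' r g := by
    refine mul_left_cancel₀ (X_sub_X_ne_zero p) ?_
    rw [(exists_mul_eq_sub_rename p (r • g)).choose_spec, RingHom.id_apply, mul_smul_comm,
      (exists_mul_eq_sub_rename p g).choose_spec, map_smul, smul_sub]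

open MvPolynomial in
theorem mul_divDiff (p : ℕ) (g : MvPolynomial ℕ ℚ) :
    (X p - X (p + 1)) * divDiff p g = g - rename (sT p) g :=
  (exists_mul_eq_sub_rename p g).choose_spec

open MvPolynomial in
theorem divDiff_eq_of_mul_eq {p : ℕ} {g q : MvPolynomial ℕ ℚ}
    (h : (X p - X (p + 1)) * q = g - rename (sT p) g) : divDiff p g = q :=
  mul_left_cancel₀ (X_sub_X_ne_zero p) ((mul_divDiff p g).trans h.symm)

open MvPolynomial in
theorem rename_mul_perm (w w' : Equiv.Perm ℕ) (g : MvPolynomial ℕ ℚ) :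
    rename w (rename w' g) = rename (w * w' : Equiv.Perm ℕ) g := by
  rw [rename_rename]
  rfl

open MvPolynomial in
theorem rename_divDiff (p : ℕ) (g : MvPolynomial ℕ ℚ) :
    rename (sT p) (divDiff p g) = divDiff p g := by
  have h := congrArg (rename (sT p)) (mul_divDiff p g)
  rw [map_mul, map_sub, map_sub, rename_X, rename_X, sT_apply_left, sT_apply_right,
    rename_mul_perm, sT_mul_sT] at h
  have h1 : rename (1 : Equiv.Perm ℕ) g = g := rename_id_apply g
  rw [h1] at h
  refine mul_left_cancel₀ (X_sub_X_ne_zero p) ?_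
  linear_combination -h - mul_divDiff p g

theorem divDiff_divDiff (p : ℕ) (g : MvPolynomial ℕ ℚ) : divDiff p (divDiff p g) = 0 := by
  apply divDiff_eq_of_mul_eq
  rw [rename_divDiff]
  ring

theorem sT_mul_comm {p q : ℕ} (h : p + 2 ≤ q) : sT p * sT q = sT q * sT p := by
  ext x
  simp only [Equiv.Perm.mul_apply, sT_apply]
  grind

theorem sT_braid (p : ℕ) : sT p * sT (p + 1) * sT p = sT (p + 1) * sT p * sT (p + 1) := by
  ext x
  simp only [Equiv.Perm.mul_apply, sT_apply]
  grind

open MvPolynomial in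
theorem divDiff_comm {p q : ℕ} (h : p + 2 ≤ q) (g : MvPolynomial ℕ ℚ) :
    divDiff p (divDiff q g) = divDiff q (divDiff p g) := by
  refine mul_left_cancel₀ (X_sub_X_ne_zero p) (mul_left_cancel₀ (X_sub_X_ne_zero q) ?_)
  have h1 := congrArg (rename (sT p)) (mul_divDiff q g)
  have h2 := congrArg (rename (sT q)) (mul_divDiff p g)
  simp only [map_mul, map_sub, rename_X, rename_mul_perm] at h1 h2
  rw [sT_apply_of_ne (by omega) (by omega), sT_apply_of_ne (by omega) (by omega)] at h1 h2
  rw [sT_mul_comm h] at h1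
  linear_combination (X q - X (q + 1)) * mul_divDiff p (divDiff q g) + mul_divDiff q g - h1
    - (X p - X (p + 1)) * mul_divDiff q (divDiff p g) - mul_divDiff p g + h2

open MvPolynomial in
theorem divDiff_braid (p : ℕ) (g : MvPolynomial ℕ ℚ) :
    divDiff p (divDiff (p + 1) (divDiff p g)) =
      divDiff (p + 1) (divDiff p (divDiff (p + 1) g)) := by
  have hne : (X p - X (p + 2) : MvPolynomial ℕ ℚ) ≠ 0 := by
    rw [sub_ne_zero]
    intro h
    have := MvPolynomial.X_injective h
    omega
  refine mul_left_cancel₀ (X_sub_X_ne_zero p) (mul_left_cancel₀ (X_sub_X_ne_zero (p + 1))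
    (mul_left_cancel₀ hne ?_))
  have e1 : sT p (p + 1 + 1) = p + 2 := sT_apply_of_ne (by omega) (by omega)
  have e2 : sT (p + 1) p = p := sT_apply_of_ne (by omega) (by omega)
  have e3 : sT (p + 1) (p + 2) = p + 1 := sT_apply_right _
  have a1 := mul_divDiff p g
  have a2 := congrArg (rename (sT (p + 1))) a1
  have a3 := congrArg (rename (sT p)) a2
  have a4 := mul_divDiff (p + 1) (divDiff p g)
  have a5 := congrArg (rename (sT p)) a4
  have a6 := mul_divDiff p (divDiff (p + 1) (divDiff p g))
  have b1 := mul_divDiff (p + 1) g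
  have b2 := congrArg (rename (sT p)) b1
  have b3 := congrArg (rename (sT (p + 1))) b2
  have b4 := mul_divDiff p (divDiff (p + 1) g)
  have b5 := congrArg (rename (sT (p + 1))) b4
  have b6 := mul_divDiff (p + 1) (divDiff p (divDiff (p + 1) g))
  simp only [map_mul, map_sub, rename_X, rename_divDiff, sT_apply_left, sT_apply_right,
    e1, e2, e3, show p + 1 + 1 = p + 2 from rfl] at a1 a2 a3 a4 a5 a6 b1 b2 b3 b4 b5 b6 ⊢
  have hbr : rename (sT p) (rename (sT (p + 1)) (rename (sT p) g)) =
      rename (sT (p + 1)) (rename (sT p) (rename (sT (p + 1)) g)) := by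
    simp only [rename_mul_perm, ← mul_assoc, sT_braid]
  linear_combination (X (p + 1) - X (p + 2)) * (X p - X (p + 2)) * a6
    + (X p - X (p + 2)) * a4 - (X (p + 1) - X (p + 2)) * a5 + a1 - a2 + a3
    - (X p - X (p + 1)) * (X p - X (p + 2)) * b6
    - (X p - X (p + 2)) * b4 + (X p - X (p + 1)) * b5 - b1 + b2 - b3 - hbr

open MvPolynomial in
theorem divDiff_monomial_of_le (p : ℕ) {x y : ℕ} (hxy : y ≤ x) {b : ℕ →₀ ℕ} (hp : b p = 0)
    (hq : b (p + 1) = 0) :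
    divDiff p (monomial (b + Finsupp.single p x + Finsupp.single (p + 1) y) 1) =
      ∑ k ∈ Finset.range (x - y),
        monomial (b + Finsupp.single p (y + k) + Finsupp.single (p + 1) (x - 1 - k)) 1 := by
  apply divDiff_eq_of_mul_eq
  have hm : ∀ i j : ℕ, (monomial (b + Finsupp.single p i + Finsupp.single (p + 1) j) (1 : ℚ)) =
      monomial b 1 * X p ^ i * X (p + 1) ^ j := by
    intro i j
    rw [X_pow_eq_monomial, X_pow_eq_monomial, monomial_mul, monomial_mul, mul_one, mul_one]
  have hb : rename (sT p) (monomial b (1 : ℚ)) = monomial b 1 := by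
    rw [rename_monomial]
    refine congrArg (fun e => monomial e (1 : ℚ)) (Finsupp.ext fun a => ?_)
    have h : Finsupp.mapDomain (sT p) b a = b (sT p a) := by
      have h := Finsupp.mapDomain_apply (sT p).injective b (sT p a)
      rwa [show sT p (sT p a) = a from Equiv.swap_apply_self _ _ a] at h
    rw [h, sT_apply]
    split_ifs with h1 h2
    · rw [h1, hp, hq]
    · rw [h2, hp, hq]
    · rfl
  simp only [hm, map_mul, map_pow, rename_X, hb, sT_apply_left, sT_apply_right]
  have hg := (Commute.all (X p : MvPolynomial ℕ ℚ) (X (p + 1))).mul_geom_sum₂ (x - y)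
  have hs : ∑ k ∈ Finset.range (x - y),
        (monomial b (1 : ℚ)) * X p ^ (y + k) * X (p + 1) ^ (x - 1 - k) =
      monomial b 1 * X p ^ y * X (p + 1) ^ y *
        ∑ i ∈ Finset.range (x - y), X p ^ i * X (p + 1) ^ (x - y - 1 - i) := by
    rw [Finset.mul_sum]
    refine Finset.sum_congr rfl fun k hk => ?_
    rw [Finset.mem_range] at hk
    rw [show x - 1 - k = y + (x - y - 1 - k) by omega, pow_add, pow_add]
    ring
  have hx : ∀ z : MvPolynomial ℕ ℚ, z ^ x = z ^ y * z ^ (x - y) := by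
    intro z
    rw [← pow_add]
    congr 1
    omega
  rw [hs, hx, hx]
  linear_combination monomial b 1 * X p ^ y * X (p + 1) ^ y * hg

theorem prod_swap_apply (s c : ℕ) {k : ℕ} (hk : 2 * k ≤ c) (x : ℕ) :
    (((List.range k).map fun i => Equiv.swap (s + i + 1) (s + c - i)).prod : Equiv.Perm ℕ) x =
      if (s + 1 ≤ x ∧ x ≤ s + k) ∨ (s + c + 1 ≤ x + k ∧ x ≤ s + c) then 2 * s + c + 1 - x
      else x := by
  induction k generalizing x with
  | zero =>
    rw [if_neg (by omega)]
    simp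
  | succ k ih =>
    rw [List.range_succ, List.map_append, List.prod_append, List.map_singleton,
      List.prod_singleton, Equiv.Perm.mul_apply, ih (by omega), Equiv.swap_apply_def]
    split_ifs <;> omega

theorem blockRev_apply (s c x : ℕ) :
    blockRev s c x = if s + 1 ≤ x ∧ x ≤ s + c then 2 * s + c + 1 - x else x := by
  rw [blockRev, prod_swap_apply s c (by omega)]
  split_ifs <;> omega

/-- The permutations of `ℕ` that move only elements of `{s + 1, …, s + c}`. -/
def FixesOff (s c : ℕ) (w : Equiv.Perm ℕ) : Prop :=
  ∀ p, ¬(s + 1 ≤ p ∧ p ≤ s + c) → w p = p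

theorem FixesOff.apply_mem {s c : ℕ} {w : Equiv.Perm ℕ} (hw : FixesOff s c w) {p : ℕ}
    (hp : s + 1 ≤ p ∧ p ≤ s + c) : s + 1 ≤ w p ∧ w p ≤ s + c := by
  by_contra h
  have h1 := w.injective (hw _ h)
  exact h (by rwa [h1])

theorem FixesOff.one (s c : ℕ) : FixesOff s c 1 := fun _ _ => rfl

theorem FixesOff.mul {s c : ℕ} {w w' : Equiv.Perm ℕ} (hw : FixesOff s c w)
    (hw' : FixesOff s c w') : FixesOff s c (w * w') := by
  intro p hp
  rw [Equiv.Perm.mul_apply, hw' p hp, hw p hp]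

theorem fixesOff_sT {s c p : ℕ} (h : s + 1 ≤ p) (h' : p < s + c) : FixesOff s c (sT p) := by
  intro q hq
  exact sT_apply_of_ne (by omega) (by omega)

theorem fixesOff_blockRev (s c : ℕ) : FixesOff s c (blockRev s c) := by
  intro p hp
  rw [blockRev_apply, if_neg hp]

theorem FixesOff.eq_one {s c : ℕ} {w : Equiv.Perm ℕ} (hw : FixesOff s c w)
    (h : ∀ p, s + 1 ≤ p → p < s + c → w p < w (p + 1)) : w = 1 := by
  have hmono : StrictMono w := by
    refine strictMono_nat_of_lt_succ fun p => ?_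
    by_cases h1 : s + 1 ≤ p ∧ p ≤ s + c
    · by_cases h2 : p < s + c
      · exact h p h1.1 h2
      · rw [hw (p + 1) (by omega)]
        have := hw.apply_mem h1
        omega
    · rw [hw p h1]
      by_cases h2 : s + 1 ≤ p + 1 ∧ p + 1 ≤ s + c
      · have := hw.apply_mem h2
        omega
      · rw [hw _ h2]
        omega
  have hinv : StrictMono w.symm := by
    intro a b hab
    rw [← hmono.lt_iff_lt, Equiv.apply_symm_apply, Equiv.apply_symm_apply]
    exact hab
  ext x
  refine le_antisymm ?_ (hmono.le_apply)
  have h1 : w x ≤ w.symm (w x) := hinv.le_apply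
  rwa [Equiv.symm_apply_apply] at h1

theorem FixesOff.eq_blockRev {s c : ℕ} {w : Equiv.Perm ℕ} (hw : FixesOff s c w)
    (h : ∀ p, s + 1 ≤ p → p < s + c → w (p + 1) < w p) : w = blockRev s c := by
  have h1 : blockRev s c * w = 1 := by
    refine ((fixesOff_blockRev s c).mul hw).eq_one fun p hp hp' => ?_
    rw [Equiv.Perm.mul_apply, Equiv.Perm.mul_apply, blockRev_apply, blockRev_apply]
    have h2 := hw.apply_mem ⟨hp, hp'.le⟩
    have h3 := hw.apply_mem (p := p + 1) ⟨by omega, by omega⟩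
    rw [if_pos h2, if_pos h3]
    have := h p hp hp'
    omega
  have h2 : blockRev s c * blockRev s c = 1 := by
    ext x
    rw [Equiv.Perm.mul_apply, blockRev_apply, blockRev_apply]
    simp only [Equiv.Perm.one_apply]
    split_ifs <;> omega
  exact mul_left_cancel (h1.trans h2.symm)

theorem FixesOff.inversion_mem {s c p q : ℕ} {w : Equiv.Perm ℕ} (hw : FixesOff s c w)
    (hpq : p < q) (h : w q < w p) : s + 1 ≤ p ∧ q ≤ s + c := by
  by_cases h1 : s + 1 ≤ p ∧ p ≤ s + c <;> by_cases h2 : s + 1 ≤ q ∧ q ≤ s + c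
  · exact ⟨h1.1, h2.2⟩
  · rw [hw q h2] at h
    have := hw.apply_mem h1
    omega
  · rw [hw p h1] at h
    have := hw.apply_mem h2
    omega
  · rw [hw p h1, hw q h2] at h
    omega

theorem FixesOff.len_le {s c : ℕ} {w : Equiv.Perm ℕ} (hw : FixesOff s c w) :
    len (s + c) w ≤ len (s + c) (blockRev s c) := by
  rw [len_eq_card, len_eq_card]
  refine Finset.card_le_card ?_
  rintro ⟨p, q⟩ h
  rw [mem_inversions] at h ⊢
  have := hw.inversion_mem h.2.2.1 h.2.2.2
  rw [blockRev_apply, blockRev_apply, if_pos (by omega), if_pos (by omega)]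
  omega

/-- The exponent vector of the top Schubert polynomial of the block `{s + 1, …, s + c}`. -/
noncomputable def staircase (s c : ℕ) : ℕ →₀ ℕ :=
  Finsupp.onFinset (Finset.Icc 1 (s + c)) (fun p => if s + 1 ≤ p then s + c - p else 0) (by
    intro p hp
    rw [Finset.mem_Icc]
    by_cases h : s + 1 ≤ p
    · rw [if_pos h] at hp
      omega
    · rw [if_neg h] at hp
      omega)

theorem staircase_apply (s c p : ℕ) :
    staircase s c p = if s + 1 ≤ p then s + c - p else 0 := rfl

theorem degree_staircase (s c : ℕ) : (staircase s c).degree = len (s + c) (blockRev s c) := by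
  have h : (staircase s c).degree = ∑ p ∈ Finset.Icc 1 (s + c), staircase s c p := by
    rw [Finsupp.degree_apply]
    refine Finset.sum_subset Finsupp.support_onFinset_subset fun p _ hp => ?_
    rwa [Finsupp.notMem_support_iff] at hp
  rw [h, len, Finset.card_filter, Finset.sum_product]
  refine Finset.sum_congr rfl fun p hp => ?_
  rw [Finset.mem_Icc] at hp
  rw [← Finset.card_filter, staircase_apply]
  by_cases h1 : s + 1 ≤ p
  · rw [if_pos h1, ← Nat.card_Ioc]
    congr 1
    ext q
    simp only [Finset.mem_Ioc, Finset.mem_filter, Finset.mem_Icc]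
    refine ⟨fun hq => ⟨⟨by omega, by omega⟩, hq.1, ?_⟩, fun hq => ⟨hq.2.1, hq.1.2⟩⟩
    rw [blockRev_apply, blockRev_apply, if_pos (by omega), if_pos (by omega)]
    omega
  · rw [if_neg h1, eq_comm, Finset.card_eq_zero, Finset.filter_eq_empty_iff]
    rintro q - ⟨hpq, hq⟩
    exact h1 ((fixesOff_blockRev s c).inversion_mem hpq hq).1

open MvPolynomial in
/-- `IsSchubert s c w g` says that `g` is obtained from the top monomial of the block by the
divided differences along a chain of simple transpositions from the block reversal to `w`. -/
inductive IsSchubert (s c : ℕ) : Equiv.Perm ℕ → MvPolynomial ℕ ℚ → Prop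
  | top : IsSchubert s c (blockRev s c) (monomial (staircase s c) 1)
  | step {w : Equiv.Perm ℕ} {g : MvPolynomial ℕ ℚ} {p : ℕ} : IsSchubert s c w g → s + 1 ≤ p →
      p < s + c → w (p + 1) < w p → IsSchubert s c (w * sT p) (divDiff p g)

theorem IsSchubert.fixesOff {s c : ℕ} {w : Equiv.Perm ℕ} {g : MvPolynomial ℕ ℚ}
    (h : IsSchubert s c w g) : FixesOff s c w := by
  induction h with
  | top => exact fixesOff_blockRev s c
  | step _ h1 h2 _ ih => exact ih.mul (fixesOff_sT h1 h2)

theorem Equiv.Perm.lt_of_not_lt {w : Equiv.Perm ℕ} {p : ℕ} (h : ¬w p < w (p + 1)) :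
    w (p + 1) < w p := by
  refine lt_of_le_of_ne (not_lt.1 h) fun h1 => ?_
  have := w.injective h1
  omega

theorem mul_sT_apply_left (w : Equiv.Perm ℕ) (p : ℕ) : (w * sT p) p = w (p + 1) := by
  rw [Equiv.Perm.mul_apply, sT_apply_left]

theorem mul_sT_apply_right (w : Equiv.Perm ℕ) (p : ℕ) : (w * sT p) (p + 1) = w p := by
  rw [Equiv.Perm.mul_apply, sT_apply_right]

theorem mul_sT_apply_of_ne (w : Equiv.Perm ℕ) {p q : ℕ} (h : q ≠ p) (h' : q ≠ p + 1) :
    (w * sT p) q = w q := by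
  rw [Equiv.Perm.mul_apply, sT_apply_of_ne h h']

theorem IsSchubert.of_mul_sT {s c p : ℕ} {w : Equiv.Perm ℕ} {g : MvPolynomial ℕ ℚ}
    (h : IsSchubert s c (w * sT p) g) (hp : s + 1 ≤ p) (hp' : p < s + c)
    (hw : w p < w (p + 1)) : IsSchubert s c w (divDiff p g) := by
  have h1 := h.step hp hp' (by rwa [mul_sT_apply_left, mul_sT_apply_right])
  rwa [mul_sT_mul_sT] at h1

theorem FixesOff.exists_isSchubert {s c : ℕ} {w : Equiv.Perm ℕ} (hw : FixesOff s c w) :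
    ∃ g, IsSchubert s c w g := by
  obtain ⟨d, hd⟩ : ∃ d, len (s + c) (blockRev s c) - len (s + c) w = d := ⟨_, rfl⟩
  induction d using Nat.strong_induction_on generalizing w with
  | _ d ih =>
    by_cases h : ∀ p, s + 1 ≤ p → p < s + c → w (p + 1) < w p
    · exact ⟨_, hw.eq_blockRev h ▸ IsSchubert.top⟩
    · push Not at h
      obtain ⟨p, hp, hp', hwp⟩ := h
      have hlt : w p < w (p + 1) := by
        refine lt_of_le_of_ne hwp fun h1 => ?_
        have := w.injective h1
        omega
      have h1 := len_mul_sT_of_lt (n := s + c) (by omega) (by omega) hlt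
      have h2 := hw.mul (fixesOff_sT hp hp')
      have h3 := h2.len_le
      obtain ⟨g, hg⟩ := ih _ (by omega) h2 rfl
      exact ⟨_, hg.of_mul_sT hp hp' hlt⟩

theorem IsSchubert.unique {s c : ℕ} {w : Equiv.Perm ℕ} {g h : MvPolynomial ℕ ℚ}
    (hg : IsSchubert s c w g) (hh : IsSchubert s c w h) : g = h := by
  obtain ⟨d, hd⟩ : ∃ d, len (s + c) (blockRev s c) - len (s + c) w = d := ⟨_, rfl⟩
  induction d using Nat.strong_induction_on generalizing w g h with
  | _ d ih =>
    have key : ∀ {p q : ℕ} {g h : MvPolynomial ℕ ℚ}, s + 1 ≤ p → p < s + c → s + 1 ≤ q →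
        q < s + c → w p < w (p + 1) → w q < w (q + 1) → p < q → IsSchubert s c (w * sT p) g →
        IsSchubert s c (w * sT q) h → divDiff p g = divDiff q h := by
      intro p q g h hp hp' hq hq' hwp hwq hpq hg hh
      have l1 := len_mul_sT_of_lt (n := s + c) (by omega) (by omega) hwp
      have l2 := len_mul_sT_of_lt (n := s + c) (by omega) (by omega) hwq
      have m1 := hg.fixesOff.len_le
      have m2 := hh.fixesOff.len_le
      rcases (show p + 2 ≤ q ∨ q = p + 1 by omega) with h2 | rfl
      · have hu := hg.fixesOff.mul (fixesOff_sT hq hq')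
        obtain ⟨k, hk⟩ := hu.exists_isSchubert
        have hk1 := hk.of_mul_sT hq hq' (by
          rwa [mul_sT_apply_of_ne _ (by omega) (by omega),
            mul_sT_apply_of_ne _ (by omega) (by omega)])
        rw [mul_assoc, sT_mul_comm h2, ← mul_assoc] at hk
        have hk2 := hk.of_mul_sT hp hp' (by
          rwa [mul_sT_apply_of_ne _ (by omega) (by omega),
            mul_sT_apply_of_ne _ (by omega) (by omega)])
        rw [ih _ (by omega) hg hk1 rfl, ih _ (by omega) hh hk2 rfl, divDiff_comm h2]
      · have hu := (hg.fixesOff.mul (fixesOff_sT hq hq')).mul (fixesOff_sT hp hp')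
        obtain ⟨k, hk⟩ := hu.exists_isSchubert
        have hk1 := (hk.of_mul_sT hp hp' (by
          rw [mul_sT_apply_left, mul_sT_apply_of_ne _ (by omega) (by omega), mul_sT_apply_left,
            mul_sT_apply_of_ne _ (by omega) (by omega)]
          exact hwq)).of_mul_sT hq hq' (by
            rw [mul_sT_apply_right, mul_sT_apply_of_ne _ (by omega) (by omega)]
            exact hwp.trans hwq)
        rw [mul_assoc, mul_assoc, ← mul_assoc (sT p), sT_braid, mul_assoc, ← mul_assoc,
          ← mul_assoc] at hk
        have hk2 := (hk.of_mul_sT hq hq' (by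
          rw [mul_sT_apply_right, mul_sT_apply_of_ne _ (by omega) (by omega),
            mul_sT_apply_of_ne _ (by omega) (by omega), mul_sT_apply_right]
          exact hwp)).of_mul_sT hp hp' (by
            rw [mul_sT_apply_left, mul_sT_apply_of_ne _ (by omega) (by omega)]
            exact hwp.trans hwq)
        rw [ih _ (by omega) hg hk1 rfl, ih _ (by omega) hh hk2 rfl, divDiff_braid]
    have asc : ∀ {u : Equiv.Perm ℕ} {p : ℕ}, u (p + 1) < u p → w = u * sT p →
        w p < w (p + 1) := by
      rintro u p hu rfl
      rwa [mul_sT_apply_left, mul_sT_apply_right]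
    have ntop : ∀ {p : ℕ}, s + 1 ≤ p → p < s + c → w p < w (p + 1) → w ≠ blockRev s c := by
      rintro p hp hp' hw rfl
      rw [blockRev_apply, blockRev_apply, if_pos (by omega), if_pos (by omega)] at hw
      omega
    have eqr : ∀ {u : Equiv.Perm ℕ} {p : ℕ}, w = u * sT p → w * sT p = u := by
      rintro u p rfl
      exact mul_sT_mul_sT _ _
    generalize hw1 : w = w1 at hg
    generalize hw2 : w = w2 at hh
    cases hg with
    | top =>
      cases hh with
      | top => rfl
      | step h1 h2 h3 h4 => exact absurd hw1 (ntop h2 h3 (asc h4 hw2))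
    | @step u k p k1 k2 k3 k4 =>
      cases hh with
      | top => exact absurd hw2 (ntop k2 k3 (asc k4 hw1))
      | @step u' k' q h1 h2 h3 h4 =>
        have a1 := asc k4 hw1
        have a2 := asc h4 hw2
        rw [← eqr hw1] at k1
        rw [← eqr hw2] at h1
        rcases lt_trichotomy p q with hpq | rfl | hpq
        · exact key k2 k3 h2 h3 a1 a2 hpq k1 h1
        · have l1 := len_mul_sT_of_lt (n := s + c) (by omega) (by omega) a1
          have m1 := k1.fixesOff.len_le
          rw [ih _ (by omega) k1 h1 rfl]
        · exact (key h2 h3 k2 k3 a2 a1 hpq h1 k1).symm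

theorem IsSchubert.divDiff_eq_zero {s c p : ℕ} {w : Equiv.Perm ℕ} {g : MvPolynomial ℕ ℚ}
    (h : IsSchubert s c w g) (hp : s + 1 ≤ p) (hp' : p < s + c) (hw : w p < w (p + 1)) :
    divDiff p g = 0 := by
  obtain ⟨k, hk⟩ := (h.fixesOff.mul (fixesOff_sT hp hp')).exists_isSchubert
  rw [h.unique (hk.of_mul_sT hp hp' hw), divDiff_divDiff]

open MvPolynomial in
/-- The span of the monomials of degree `d` that divide the staircase monomial. -/
noncomputable def staircaseSpan (s c d : ℕ) : Submodule ℚ (MvPolynomial ℕ ℚ) :=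
  Submodule.span ℚ ((fun a : ℕ →₀ ℕ => monomial a (1 : ℚ)) ''
    {a | a ≤ staircase s c ∧ a.degree = d})

open MvPolynomial in
theorem monomial_mem_staircaseSpan {s c d : ℕ} {a : ℕ →₀ ℕ} (h : a ≤ staircase s c)
    (hd : a.degree = d) : monomial a (1 : ℚ) ∈ staircaseSpan s c d :=
  Submodule.subset_span ⟨a, ⟨h, hd⟩, rfl⟩

open MvPolynomial in
theorem divDiff_rename (p : ℕ) (g : MvPolynomial ℕ ℚ) :
    divDiff p (rename (sT p) g) = -divDiff p g := by
  apply divDiff_eq_of_mul_eq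
  have h1 : rename (1 : Equiv.Perm ℕ) g = g := rename_id_apply g
  rw [rename_mul_perm, sT_mul_sT, h1]
  linear_combination -mul_divDiff p g

theorem sum_single_le_staircase {s c p : ℕ} (hp : s + 1 ≤ p) {b : ℕ →₀ ℕ}
    (hb : b ≤ staircase s c) (h0 : b p = 0) (h1 : b (p + 1) = 0) {i j : ℕ}
    (hi : i ≤ s + c - p) (hj : j ≤ s + c - (p + 1)) :
    b + Finsupp.single p i + Finsupp.single (p + 1) j ≤ staircase s c := by
  intro q
  have := hb q
  rw [staircase_apply] at this ⊢
  simp only [Finsupp.add_apply, Finsupp.single_apply]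
  by_cases hq : p = q
  · subst hq
    rw [if_pos rfl, if_neg (by omega), if_pos hp]
    omega
  · by_cases hq' : p + 1 = q
    · subst hq'
      rw [if_neg hq, if_pos rfl, if_pos (by omega)]
      omega
    · rw [if_neg hq, if_neg hq']
      omega

theorem rename_sT_monomial (p x y : ℕ) {b : ℕ →₀ ℕ} (h0 : b p = 0) (h1 : b (p + 1) = 0) :
    MvPolynomial.rename (sT p) (MvPolynomial.monomial
      (b + Finsupp.single p x + Finsupp.single (p + 1) y) (1 : ℚ)) =
      MvPolynomial.monomial (b + Finsupp.single p y + Finsupp.single (p + 1) x) 1 := by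
  rw [MvPolynomial.rename_monomial]
  refine congrArg (fun e => MvPolynomial.monomial e (1 : ℚ)) (Finsupp.ext fun a => ?_)
  have h : ∀ e : ℕ →₀ ℕ, Finsupp.mapDomain (sT p) e a = e (sT p a) := by
    intro e
    have h := Finsupp.mapDomain_apply (sT p).injective e (sT p a)
    rwa [show sT p (sT p a) = a from Equiv.swap_apply_self _ _ a] at h
  rw [h, sT_apply]
  simp only [Finsupp.add_apply, Finsupp.single_apply]
  split_ifs <;> grind

theorem exists_eq_add_single (a : ℕ →₀ ℕ) (p : ℕ) :
    ∃ b : ℕ →₀ ℕ, b ≤ a ∧ b p = 0 ∧ b (p + 1) = 0 ∧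
      a = b + Finsupp.single p (a p) + Finsupp.single (p + 1) (a (p + 1)) := by
  refine ⟨(a.erase p).erase (p + 1), ?_, ?_, ?_, ?_⟩
  · intro q
    simp only [Finsupp.erase_apply]
    split_ifs <;> omega
  · simp
  · simp
  · ext q
    simp only [Finsupp.add_apply, Finsupp.single_apply, Finsupp.erase_apply]
    split_ifs <;> grind

open MvPolynomial in
theorem divDiff_mem_staircaseSpan {s c d p : ℕ} (hp : s + 1 ≤ p) (hp' : p < s + c)
    {g : MvPolynomial ℕ ℚ} (hg : g ∈ staircaseSpan s c (d + 1)) :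
    divDiff p g ∈ staircaseSpan s c d := by
  have key : ∀ {b : ℕ →₀ ℕ} {x y : ℕ}, b ≤ staircase s c → b p = 0 → b (p + 1) = 0 → y ≤ x →
      x ≤ s + c - p → b.degree + x + y = d + 1 →
      divDiff p (monomial (b + Finsupp.single p x + Finsupp.single (p + 1) y) 1) ∈
        staircaseSpan s c d := by
    intro b x y hb h0 h1 hyx hx hd
    rw [divDiff_monomial_of_le p hyx h0 h1]
    refine Submodule.sum_mem _ fun k hk => ?_
    rw [Finset.mem_range] at hk
    refine monomial_mem_staircaseSpan (sum_single_le_staircase hp hb h0 h1 (by omega) (by omega)) ?_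
    rw [map_add, map_add, Finsupp.degree_single, Finsupp.degree_single]
    omega
  refine Submodule.span_induction (p := fun g _ => divDiff p g ∈ staircaseSpan s c d) ?_ ?_ ?_ ?_
    hg
  · rintro _ ⟨a, ⟨ha, hd⟩, rfl⟩
    obtain ⟨b, hb, h0, h1, hab⟩ := exists_eq_add_single a p
    have hx := ha p
    have hy := ha (p + 1)
    rw [staircase_apply, if_pos (by omega)] at hx hy
    rw [hab, map_add, map_add, Finsupp.degree_single, Finsupp.degree_single] at hd
    simp only
    rw [hab]
    rcases le_total (a (p + 1)) (a p) with h | h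
    · exact key (hb.trans ha) h0 h1 h hx hd
    · rw [← rename_sT_monomial p _ _ h0 h1, divDiff_rename]
      exact Submodule.neg_mem _ (key (hb.trans ha) h0 h1 h (by omega) (by omega))
  · rw [map_zero]
    exact Submodule.zero_mem _
  · intro x y _ _ hx hy
    rw [map_add]
    exact Submodule.add_mem _ hx hy
  · intro r x _ hx
    rw [map_smul]
    exact Submodule.smul_mem _ _ hx

theorem IsSchubert.mem_staircaseSpan {s c : ℕ} {w : Equiv.Perm ℕ} {g : MvPolynomial ℕ ℚ}
    (h : IsSchubert s c w g) : g ∈ staircaseSpan s c (len (s + c) w) := by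
  induction h with
  | top => exact monomial_mem_staircaseSpan le_rfl (degree_staircase s c)
  | @step w g p h h1 h2 h3 ih =>
    apply divDiff_mem_staircaseSpan h1 h2
    rwa [len_mul_sT_of_gt (by omega) (by omega) h3]

/-- The permutations on a chain from the block reversal to the identity along which all the
Schubert polynomials are monomials. -/
def chainPerm (s J k p : ℕ) : ℕ :=
  if p ≤ s then p
  else if p ≤ s + k then 2 * s + J - p
  else if p = s + k + 1 then s + J
  else if p ≤ s + J then 2 * s + J + 1 - p
  else p

/-- The exponent of the Schubert polynomial of `chainPerm`. -/
def chainExp (s J k p : ℕ) : ℕ :=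
  if p ≤ s then 0 else if p ≤ s + k then s + J - 1 - p else s + J - p

open MvPolynomial in
theorem exists_isSchubert_chain_step {s c J k : ℕ} (hJ : J ≤ c) (hk : k + 1 < J)
    (h : ∃ w a, IsSchubert s c w (monomial a 1) ∧ (∀ p, w p = chainPerm s J k p) ∧
      ∀ p, a p = chainExp s J k p) :
    ∃ w a, IsSchubert s c w (monomial a 1) ∧ (∀ p, w p = chainPerm s J (k + 1) p) ∧
      ∀ p, a p = chainExp s J (k + 1) p := by
  obtain ⟨w, a, hwa, hw, ha⟩ := h
  obtain ⟨b, hb, h0, h1, hab⟩ := exists_eq_add_single a (s + k + 1)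
  have e1 : a (s + k + 1) = J - k - 1 := by
    rw [ha, chainExp, if_neg (by omega), if_neg (by omega)]
    omega
  have e2 : a (s + k + 1 + 1) = J - k - 2 := by
    rw [ha, chainExp, if_neg (by omega), if_neg (by omega)]
    omega
  have hlt : w (s + k + 1 + 1) < w (s + k + 1) := by
    rw [hw, hw]
    unfold chainPerm
    split_ifs <;> omega
  have h2 := hwa.step (p := s + k + 1) (by omega) (by omega) hlt
  rw [hab, divDiff_monomial_of_le _ (by omega) h0 h1, e1, e2,
    show J - k - 1 - (J - k - 2) = 1 by omega, Finset.sum_range_one] at h2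
  refine ⟨_, _, h2, fun p => ?_, fun p => ?_⟩
  · rw [Equiv.Perm.mul_apply, hw, sT_apply]
    unfold chainPerm
    split_ifs <;> omega
  · have h3 := ha p
    rw [hab] at h3
    simp only [Finsupp.add_apply, Finsupp.single_apply, e1, e2] at h3 ⊢
    unfold chainExp at h3 ⊢
    have : p = s + k + 1 → b p = 0 := fun h => h ▸ h0
    have : p = s + k + 1 + 1 → b p = 0 := fun h => h ▸ h1
    split_ifs at h3 ⊢ <;> omega

open MvPolynomial in
theorem isSchubert_one_one (s c : ℕ) : IsSchubert s c 1 1 := by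
  rcases Nat.eq_zero_or_pos c with rfl | hc
  · have h := IsSchubert.top (s := s) (c := 0)
    have h1 : blockRev s 0 = 1 := rfl
    have h2 : staircase s 0 = 0 := by
      ext p
      rw [staircase_apply, Finsupp.zero_apply]
      split_ifs <;> omega
    rwa [h1, h2] at h
  have inner : ∀ J ≤ c, (∃ w a, IsSchubert s c w (monomial a 1) ∧
      (∀ p, w p = chainPerm s J 0 p) ∧ ∀ p, a p = chainExp s J 0 p) → ∀ k < J,
      ∃ w a, IsSchubert s c w (monomial a 1) ∧ (∀ p, w p = chainPerm s J k p) ∧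
      ∀ p, a p = chainExp s J k p := by
    intro J hJ h k
    induction k with
    | zero => exact fun _ => h
    | succ k ih => exact fun hk => exists_isSchubert_chain_step hJ hk (ih (by omega))
  have outer : ∀ j < c, ∃ w a, IsSchubert s c w (monomial a 1) ∧
      (∀ p, w p = chainPerm s (c - j) 0 p) ∧ ∀ p, a p = chainExp s (c - j) 0 p := by
    intro j
    induction j with
    | zero =>
      refine fun _ => ⟨_, _, IsSchubert.top, fun p => ?_, fun p => ?_⟩
      · rw [blockRev_apply]
        unfold chainPerm
        split_ifs <;> omega
      · rw [staircase_apply]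
        unfold chainExp
        split_ifs <;> omega
    | succ j ih =>
      intro hj
      obtain ⟨w, a, h, hw, ha⟩ := inner _ (by omega) (ih (by omega)) (c - j - 1) (by omega)
      refine ⟨w, a, h, fun p => ?_, fun p => ?_⟩
      · rw [hw]
        unfold chainPerm
        split_ifs <;> omega
      · rw [ha]
        unfold chainExp
        split_ifs <;> omega
  obtain ⟨w, a, h, hw, ha⟩ := outer (c - 1) (by omega)
  have h1 : w = 1 := by
    ext p
    rw [hw, Equiv.Perm.one_apply]
    unfold chainPerm
    split_ifs <;> omega
  have h2 : a = 0 := by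
    ext p
    rw [ha, Finsupp.zero_apply]
    unfold chainExp
    split_ifs <;> omega
  rwa [h1, h2] at h

open MvPolynomial in
/-- The linear functional sending a monomial `x ^ a` to `∏ᵢ (s + aₛ₊₁₊ᵢ).choose (t i)`. -/
noncomputable def binomFunctional (s c : ℕ) (t : ℕ → ℕ) : MvPolynomial ℕ ℚ →ₗ[ℚ] ℚ :=
  (basisMonomials ℕ ℚ).constr ℚ
    (fun a => ∏ i ∈ Finset.range c, ((s + a (s + 1 + i)).choose (t i) : ℚ))

open MvPolynomial in
theorem binomFunctional_monomial (s c : ℕ) (t : ℕ → ℕ) (a : ℕ →₀ ℕ) :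
    binomFunctional s c t (monomial a 1) =
      ∏ i ∈ Finset.range c, ((s + a (s + 1 + i)).choose (t i) : ℚ) := by
  have h := (basisMonomials ℕ ℚ).constr_basis ℚ
    (fun a => ∏ i ∈ Finset.range c, ((s + a (s + 1 + i)).choose (t i) : ℚ)) a
  rwa [coe_basisMonomials] at h

theorem prod_range_eq_mul_mul {c i : ℕ} (hi : i + 1 < c) (F : ℕ → ℚ) :
    ∏ j ∈ Finset.range c, F j =
      (∏ j ∈ ((Finset.range c).erase (i + 1)).erase i, F j) * F i * F (i + 1) := by
  rw [Finset.prod_erase_mul, Finset.prod_erase_mul]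
  · simpa using hi
  · simp
    omega

open MvPolynomial in
theorem binomFunctional_monomial_add (s : ℕ) {c i : ℕ} (hi : i + 1 < c) (t : ℕ → ℕ)
    {b : ℕ →₀ ℕ} (h0 : b (s + 1 + i) = 0) (h1 : b (s + 1 + i + 1) = 0) (x y : ℕ) :
    binomFunctional s c t (monomial
      (b + Finsupp.single (s + 1 + i) x + Finsupp.single (s + 1 + i + 1) y) 1) =
      (∏ j ∈ ((Finset.range c).erase (i + 1)).erase i, ((s + b (s + 1 + j)).choose (t j) : ℚ)) *
        (s + x).choose (t i) * (s + y).choose (t (i + 1)) := by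
  rw [binomFunctional_monomial, prod_range_eq_mul_mul hi]
  congr 1
  · congr 1
    · refine Finset.prod_congr rfl fun j hj => ?_
      simp only [Finset.mem_erase] at hj
      simp only [Finsupp.add_apply, Finsupp.single_apply]
      rw [if_neg (by omega), if_neg (by omega), add_zero, add_zero]
    · simp [h0]
  · simp only [Finsupp.add_apply, Finsupp.single_apply]
    rw [if_neg (by omega), if_pos (by omega), ← add_assoc (s + 1) i 1, h1]
    simp

open MvPolynomial in
theorem linearMap_ext_monomial {A B : MvPolynomial ℕ ℚ →ₗ[ℚ] ℚ}
    (h : ∀ a, A (monomial a 1) = B (monomial a 1)) : A = B :=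
  (basisMonomials ℕ ℚ).ext fun a => by
    rw [coe_basisMonomials]
    exact h a

open MvPolynomial in
theorem binomFunctional_rename (s : ℕ) {c i : ℕ} (hi : i + 1 < c) {t : ℕ → ℕ}
    (ht : t i = t (i + 1)) (g : MvPolynomial ℕ ℚ) :
    binomFunctional s c t (rename (sT (s + 1 + i)) g) = binomFunctional s c t g := by
  suffices h : binomFunctional s c t ∘ₗ (rename (sT (s + 1 + i))).toLinearMap =
      binomFunctional s c t from LinearMap.congr_fun h g
  refine linearMap_ext_monomial fun a => ?_
  obtain ⟨b, -, h0, h1, hab⟩ := exists_eq_add_single a (s + 1 + i)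
  simp only [LinearMap.comp_apply, AlgHom.toLinearMap_apply]
  rw [hab, rename_sT_monomial _ _ _ h0 h1, binomFunctional_monomial_add s hi t h0 h1,
    binomFunctional_monomial_add s hi t h0 h1, ht]
  ring

open MvPolynomial in
theorem binomFunctional_mul_sub (s : ℕ) {c i : ℕ} (hi : i + 1 < c) {t t' : ℕ → ℕ}
    (ht : t (i + 1) = t i + 1) (ht' : t' i = t i + 1) (h : ∀ j ≠ i, t' j = t j)
    (g : MvPolynomial ℕ ℚ) :
    binomFunctional s c t' ((X (s + 1 + i) - X (s + 1 + i + 1)) * g) =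
      binomFunctional s c t g - binomFunctional s c t (rename (sT (s + 1 + i)) g) := by
  suffices h : binomFunctional s c t' ∘ₗ
      LinearMap.mulLeft ℚ (X (s + 1 + i) - X (s + 1 + i + 1)) =
      binomFunctional s c t -
        binomFunctional s c t ∘ₗ (rename (sT (s + 1 + i))).toLinearMap from
    LinearMap.congr_fun h g
  refine linearMap_ext_monomial fun a => ?_
  obtain ⟨b, -, h0, h1, hab⟩ := exists_eq_add_single a (s + 1 + i)
  simp only [LinearMap.comp_apply, AlgHom.toLinearMap_apply, LinearMap.sub_apply,
    LinearMap.mulLeft_apply]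
  generalize a (s + 1 + i) = x at hab
  generalize a (s + 1 + i + 1) = y at hab
  have e1 : X (s + 1 + i) * monomial a (1 : ℚ) = monomial
      (b + Finsupp.single (s + 1 + i) (x + 1) + Finsupp.single (s + 1 + i + 1) y) 1 := by
    rw [X, monomial_mul, hab, mul_one, Finsupp.single_add]
    congr 2
    abel
  have e2 : X (s + 1 + i + 1) * monomial a (1 : ℚ) = monomial
      (b + Finsupp.single (s + 1 + i) x + Finsupp.single (s + 1 + i + 1) (y + 1)) 1 := by
    rw [X, monomial_mul, hab, mul_one, Finsupp.single_add]
    congr 2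
    abel
  rw [sub_mul, map_sub, e1, e2, hab, rename_sT_monomial _ _ _ h0 h1]
  simp only [binomFunctional_monomial_add s hi _ h0 h1]
  have hprod : ∏ j ∈ ((Finset.range c).erase (i + 1)).erase i,
      ((s + b (s + 1 + j)).choose (t' j) : ℚ) =
      ∏ j ∈ ((Finset.range c).erase (i + 1)).erase i, ((s + b (s + 1 + j)).choose (t j) : ℚ) := by
    refine Finset.prod_congr rfl fun j hj => ?_
    rw [h j (by simp only [Finset.mem_erase] at hj; exact hj.1)]
  rw [hprod, h (i + 1) (by omega), ht, ht', ← add_assoc, ← add_assoc, Nat.choose_succ_succ,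
    Nat.choose_succ_succ]
  push_cast
  ring

open MvPolynomial in
/-- The Vandermonde determinant in the variables of the block `{s + 1, …, s + c}`. -/
noncomputable def blockVandermonde (s c : ℕ) : MvPolynomial ℕ ℚ :=
  (Matrix.vandermonde fun i : Fin c => (X (s + 1 + (i : ℕ)) : MvPolynomial ℕ ℚ)).det

open MvPolynomial in
theorem rename_blockVandermonde (s : ℕ) {c i : ℕ} (hi : i + 1 < c) :
    rename (sT (s + 1 + i)) (blockVandermonde s c) = -blockVandermonde s c := by
  let σ : Equiv.Perm (Fin c) := Equiv.swap ⟨i, by omega⟩ ⟨i + 1, hi⟩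
  have h : (rename (sT (s + 1 + i)) : MvPolynomial ℕ ℚ →ₐ[ℚ] _).mapMatrix
      (Matrix.vandermonde fun i : Fin c => (X (s + 1 + (i : ℕ)) : MvPolynomial ℕ ℚ)) =
      (Matrix.vandermonde fun i : Fin c =>
        (X (s + 1 + (i : ℕ)) : MvPolynomial ℕ ℚ)).submatrix σ id := by
    ext1 j k
    rw [AlgHom.mapMatrix_apply, Matrix.map_apply, Matrix.submatrix_apply,
      Matrix.vandermonde_apply, Matrix.vandermonde_apply, map_pow, rename_X, sT_apply]
    simp only [σ, Equiv.swap_apply_def, Fin.ext_iff, id]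
    congr 2
    split_ifs <;> grind
  rw [blockVandermonde, AlgHom.map_det, h, Matrix.det_permute, Equiv.Perm.sign_swap]
  · simp
  · simp

/-- The exponents of the terms of `x ^ a` times the Vandermonde determinant. -/
noncomputable def vandermondeExp (s : ℕ) {c : ℕ} (a : ℕ →₀ ℕ) (σ : Equiv.Perm (Fin c)) : ℕ →₀ ℕ :=
  a + ∑ i, Finsupp.single (s + 1 + (σ i : ℕ)) (i : ℕ)

theorem vandermondeExp_apply (s : ℕ) {c : ℕ} (a : ℕ →₀ ℕ) (σ : Equiv.Perm (Fin c)) (i : Fin c) :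
    vandermondeExp s a σ (s + 1 + (σ i : ℕ)) = a (s + 1 + (σ i : ℕ)) + i := by
  rw [vandermondeExp, Finsupp.add_apply, Finsupp.finsetSum_apply, Finset.sum_eq_single i]
  · simp
  · intro j _ hj
    rw [Finsupp.single_apply, if_neg]
    intro h
    exact hj (σ.injective (Fin.ext (by omega)))
  · simp

open MvPolynomial in
theorem monomial_mul_blockVandermonde (s c : ℕ) (a : ℕ →₀ ℕ) :
    monomial a 1 * blockVandermonde s c = ∑ σ : Equiv.Perm (Fin c),
      ((Equiv.Perm.sign σ : ℤ) : ℚ) • monomial (vandermondeExp s a σ) 1 := by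
  rw [blockVandermonde, Matrix.det_apply, Finset.mul_sum]
  refine Finset.sum_congr rfl fun σ _ => ?_
  have h : monomial (vandermondeExp s a σ) (1 : ℚ) =
      monomial a 1 * ∏ i, Matrix.vandermonde (fun i : Fin c => X (s + 1 + (i : ℕ))) (σ i) i := by
    rw [vandermondeExp, ← one_mul (1 : ℚ), ← monomial_mul, one_mul, monomial_sum_one]
    refine congrArg _ (Finset.prod_congr rfl fun i _ => ?_)
    rw [Matrix.vandermonde_apply, X_pow_eq_monomial]
  rw [h, mul_smul_comm, Units.smul_def, Int.cast_smul_eq_zsmul]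

open MvPolynomial in
theorem binomFunctional_monomial_mul (s c : ℕ) (t : ℕ → ℕ) (a : ℕ →₀ ℕ) :
    binomFunctional s c t (monomial a 1 * blockVandermonde s c) =
      (Matrix.of fun i j : Fin c =>
        ((s + (a (s + 1 + (i : ℕ)) + (j : ℕ))).choose (t i) : ℚ)).det := by
  rw [monomial_mul_blockVandermonde, map_sum, Matrix.det_apply']
  refine Finset.sum_congr rfl fun σ _ => ?_
  rw [map_smul, smul_eq_mul, binomFunctional_monomial, Finset.prod_range, ← Equiv.prod_comp σ]
  congr 1
  refine Finset.prod_congr rfl fun i _ => ?_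
  rw [vandermondeExp_apply, Matrix.of_apply]

/-- The lower indices `s, s + 1, …` with the entry at `q` increased by one. -/
def shiftedIndex (s q j : ℕ) : ℕ := if j = q then s + j + 1 else s + j

open MvPolynomial in
theorem sum_binomFunctional_monomial (s c : ℕ) (e : ℕ →₀ ℕ) :
    ∑ i ∈ Finset.range c, ((s + 1 + i : ℕ) : ℚ) *
        binomFunctional s c (shiftedIndex s i) (monomial e 1) =
      (∑ i ∈ Finset.range c, ((e (s + 1 + i) : ℚ) - i)) *
        binomFunctional s c (fun j => s + j) (monomial e 1) := by
  rw [Finset.sum_mul]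
  refine Finset.sum_congr rfl fun i hi => ?_
  rw [binomFunctional_monomial, binomFunctional_monomial, ← Finset.mul_prod_erase _ _ hi,
    ← Finset.mul_prod_erase _ _ hi]
  have hprod : ∏ j ∈ (Finset.range c).erase i,
      ((s + e (s + 1 + j)).choose (shiftedIndex s i j) : ℚ) =
      ∏ j ∈ (Finset.range c).erase i, ((s + e (s + 1 + j)).choose (s + j) : ℚ) := by
    refine Finset.prod_congr rfl fun j hj => ?_
    rw [shiftedIndex, if_neg (by simp only [Finset.mem_erase] at hj; exact hj.1)]
  rw [hprod, shiftedIndex, if_pos rfl, ← mul_assoc, ← mul_assoc]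
  congr 1
  rcases le_or_gt (s + i) (s + e (s + 1 + i)) with h | h
  · have h1 := Nat.choose_succ_right_eq (s + e (s + 1 + i)) (s + i)
    have h2 : (((s + e (s + 1 + i) - (s + i) : ℕ)) : ℚ) = e (s + 1 + i) - i := by
      rw [Nat.cast_sub h]
      push_cast
      ring
    have h3 := congrArg (Nat.cast (R := ℚ)) h1
    rw [Nat.cast_mul, Nat.cast_mul] at h3
    rw [← h2, show ((s + 1 + i : ℕ) : ℚ) = ((s + i + 1 : ℕ) : ℚ) by push_cast; ring]
    linear_combination h3
  · rw [Nat.choose_eq_zero_of_lt h, Nat.choose_eq_zero_of_lt (by omega)]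
    simp

theorem sum_range_eq_degree {s c : ℕ} {a : ℕ →₀ ℕ} (ha : a ≤ staircase s c) :
    ∑ i ∈ Finset.range c, a (s + 1 + i) = a.degree := by
  rw [Finsupp.degree_apply]
  have h : ∑ i ∈ Finset.range c, a (s + 1 + i) = ∑ p ∈ Finset.Ico (s + 1) (s + 1 + c), a p := by
    rw [Finset.sum_Ico_eq_sum_range]
    simp
  rw [h, eq_comm]
  refine Finset.sum_subset (fun p hp => ?_) fun p _ hp => ?_
  · have h1 := ha p
    rw [staircase_apply] at h1
    rw [Finsupp.mem_support_iff] at hp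
    rw [Finset.mem_Ico]
    split_ifs at h1 <;> omega
  · rwa [Finsupp.notMem_support_iff] at hp

theorem sum_vandermondeExp (s : ℕ) {c : ℕ} (a : ℕ →₀ ℕ) (σ : Equiv.Perm (Fin c)) :
    ∑ i ∈ Finset.range c, vandermondeExp s a σ (s + 1 + i) =
      ∑ i ∈ Finset.range c, a (s + 1 + i) + ∑ i ∈ Finset.range c, i := by
  rw [Finset.sum_range, ← Equiv.sum_comp σ]
  simp only [vandermondeExp_apply]
  rw [Finset.sum_add_distrib, Equiv.sum_comp σ (fun i => a (s + 1 + (i : ℕ))),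
    Finset.sum_range, Finset.sum_range]

open MvPolynomial in
theorem sum_binomFunctional_mul {s c d : ℕ} {g : MvPolynomial ℕ ℚ} (hg : g ∈ staircaseSpan s c d) :
    ∑ i ∈ Finset.range c, ((s + 1 + i : ℕ) : ℚ) *
        binomFunctional s c (shiftedIndex s i) (g * blockVandermonde s c) =
      d * binomFunctional s c (fun j => s + j) (g * blockVandermonde s c) := by
  refine Submodule.span_induction (p := fun g _ => ∑ i ∈ Finset.range c, ((s + 1 + i : ℕ) : ℚ) *
        binomFunctional s c (shiftedIndex s i) (g * blockVandermonde s c) =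
      d * binomFunctional s c (fun j => s + j) (g * blockVandermonde s c)) ?_ ?_ ?_ ?_ hg
  · rintro _ ⟨a, ⟨ha, hd⟩, rfl⟩
    simp only [monomial_mul_blockVandermonde, map_sum, map_smul, smul_eq_mul, Finset.mul_sum]
    rw [Finset.sum_comm]
    refine Finset.sum_congr rfl fun σ _ => ?_
    simp only [mul_left_comm _ ((Equiv.Perm.sign σ : ℤ) : ℚ)]
    rw [← Finset.mul_sum, sum_binomFunctional_monomial, Finset.sum_sub_distrib, ← Nat.cast_sum,
      sum_vandermondeExp, sum_range_eq_degree ha, hd]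
    push_cast
    ring
  · simp
  · intro x y _ _ hx hy
    simp only [add_mul, map_add, mul_add, Finset.sum_add_distrib, hx, hy]
  · intro r x _ hx
    simp only [smul_mul_assoc, map_smul, smul_eq_mul, mul_left_comm _ r]
    rw [← Finset.mul_sum, hx]

open MvPolynomial in
theorem binomFunctional_last_eq_zero {s c d : ℕ} {g : MvPolynomial ℕ ℚ}
    (hg : g ∈ staircaseSpan s (c + 1) d) :
    binomFunctional s (c + 1) (shiftedIndex s c) (g * blockVandermonde s (c + 1)) = 0 := by
  refine Submodule.span_induction (p := fun g _ =>
    binomFunctional s (c + 1) (shiftedIndex s c) (g * blockVandermonde s (c + 1)) = 0)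
    ?_ ?_ ?_ ?_ hg
  · rintro _ ⟨a, ⟨ha, hd⟩, rfl⟩
    simp only
    rw [binomFunctional_monomial_mul]
    refine Matrix.det_eq_zero_of_row_eq_zero (Fin.last c) fun j => ?_
    have h1 := ha (s + 1 + c)
    rw [staircase_apply, if_pos (by omega)] at h1
    rw [Matrix.of_apply, Fin.val_last, shiftedIndex, if_pos rfl, Nat.choose_eq_zero_of_lt]
    · simp
    · omega
  · simp
  · intro x y _ _ hx hy
    rw [add_mul, map_add, hx, hy, add_zero]
  · intro r x _ hx
    rw [smul_mul_assoc, map_smul, hx, smul_zero]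

open MvPolynomial in
theorem binomFunctional_divDiff_mul (s : ℕ) {c i : ℕ} (hi : i + 1 < c) (g : MvPolynomial ℕ ℚ) :
    binomFunctional s c (fun j => s + j) (divDiff (s + 1 + i) g * blockVandermonde s c) =
      binomFunctional s c (shiftedIndex s i) (g * blockVandermonde s c) := by
  have ht : shiftedIndex s i i = shiftedIndex s i (i + 1) := by
    rw [shiftedIndex, shiftedIndex, if_pos rfl, if_neg (by omega)]
    rfl
  have h1 := binomFunctional_mul_sub s hi (t := fun j => s + j) (t' := shiftedIndex s i) rfl
    (by rw [shiftedIndex, if_pos rfl]) (fun j hj => by rw [shiftedIndex, if_neg hj])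
    (divDiff (s + 1 + i) g * blockVandermonde s c)
  have h2 := binomFunctional_rename s hi ht (g * blockVandermonde s c)
  rw [map_mul (rename _), rename_blockVandermonde s hi, mul_neg, map_neg] at h2
  rw [map_mul (rename _), rename_blockVandermonde s hi, rename_divDiff, mul_neg, map_neg,
    ← mul_assoc, mul_divDiff, sub_mul, map_sub] at h1
  linarith

/-- The principal specialization of a Schubert polynomial of the block `{s + 1, …, s + c}`,
as a function of that polynomial. -/
noncomputable def blockValue (s c : ℕ) (g : MvPolynomial ℕ ℚ) : ℚ :=
  binomFunctional s c (fun j => s + j) (g * blockVandermonde s c)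

theorem mul_blockValue {s c d : ℕ} {g : MvPolynomial ℕ ℚ} (hg : g ∈ staircaseSpan s c d) :
    d * blockValue s c g =
      ∑ p ∈ Finset.Ico (s + 1) (s + c), (p : ℚ) * blockValue s c (divDiff p g) := by
  rw [blockValue, ← sum_binomFunctional_mul hg, Finset.sum_Ico_eq_sum_range]
  cases c with
  | zero => simp
  | succ c =>
    rw [Finset.sum_range_succ, binomFunctional_last_eq_zero hg, mul_zero, add_zero,
      show s + (c + 1) - (s + 1) = c by omega]
    refine Finset.sum_congr rfl fun i hi => ?_
    rw [blockValue, binomFunctional_divDiff_mul s (by simpa using hi)]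

theorem blockValue_one (s c : ℕ) : blockValue s c 1 = 1 := by
  have h := binomFunctional_monomial_mul s c (fun j => s + j) 0
  rw [blockValue, ← MvPolynomial.C_1, MvPolynomial.C_apply, h, Matrix.det_of_isUpperTriangular]
  · simp
  · intro i j hij
    have : (j : ℕ) < i := hij
    rw [Matrix.of_apply, Nat.choose_eq_zero_of_lt (by simpa using this), Nat.cast_zero]

theorem blockValue_staircase (s c : ℕ) :
    blockValue s c (MvPolynomial.monomial (staircase s c) 1) =
      (Matrix.of fun i j : Fin c => ((s + (c - 1 - i + j)).choose (s + i) : ℚ)).det := by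
  rw [blockValue, binomFunctional_monomial_mul]
  congr 1
  ext i j
  rw [Matrix.of_apply, Matrix.of_apply, staircase_apply, if_pos (by omega)]
  congr 3
  omega

theorem len_ne_zero_of_gt {n i : ℕ} {w : Equiv.Perm ℕ} (hi : 1 ≤ i) (hin : i < n)
    (h : w (i + 1) < w i) : len n w ≠ 0 := by
  have := len_mul_sT_of_gt hi hin h
  omega

theorem len_mul_Upsilon_eq_sum_ite (n : ℕ) (w : Equiv.Perm ℕ) :
    (len n w : ℚ) * Upsilon n w = ∑ i ∈ Finset.Ico 1 n,
      if w (i + 1) < w i then (i : ℚ) * Upsilon n (w * sT i) else 0 := by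
  by_cases h0 : len n w = 0
  · rw [h0, Nat.cast_zero, zero_mul, eq_comm]
    refine Finset.sum_eq_zero fun i hi => if_neg fun h => ?_
    rw [Finset.mem_Ico] at hi
    exact len_ne_zero_of_gt hi.1 hi.2 h h0
  · rw [len_mul_Upsilon n w h0, Finset.sum_filter]

theorem FixesOff.eq_one_of_len_eq_zero {s c : ℕ} {w : Equiv.Perm ℕ} (hw : FixesOff s c w)
    (h0 : len (s + c) w = 0) : w = 1 := by
  refine hw.eq_one fun p hp hp' => ?_
  by_contra h
  exact len_ne_zero_of_gt (by omega) hp' (Equiv.Perm.lt_of_not_lt h) h0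

theorem FixesOff.mul_apply {s c : ℕ} {u w : Equiv.Perm ℕ} (hu : FixesOff 0 s u)
    (hw : FixesOff s c w) (p : ℕ) : (u * w) p = if p ≤ s then u p else w p := by
  rw [Equiv.Perm.mul_apply]
  split_ifs with h
  · rw [hw p (by omega)]
  · apply hu
    by_cases h1 : p ≤ s + c
    · have := hw.apply_mem ⟨by omega, h1⟩
      omega
    · rw [hw p (by omega)]
      omega

theorem FixesOff.len_mul {s c : ℕ} {u w : Equiv.Perm ℕ} (hu : FixesOff 0 s u)
    (hw : FixesOff s c w) : len (s + c) (u * w) = len s u + len (s + c) w := by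
  rw [len_eq_card, len_eq_card, len_eq_card, ← Finset.card_union_of_disjoint]
  · congr 1
    ext ⟨p, q⟩
    rw [Finset.mem_union, mem_inversions, mem_inversions, mem_inversions, hu.mul_apply hw,
      hu.mul_apply hw]
    have h1 : q ≤ s → 1 ≤ q → u q ≤ s := fun h h' => by
      have := hu.apply_mem (p := q) (by omega)
      omega
    have h2 : p ≤ s → 1 ≤ p → u p ≤ s := fun h h' => by
      have := hu.apply_mem (p := p) (by omega)
      omega
    have h3 : s < q → s < w q := fun h => by
      by_cases h' : q ≤ s + c
      · have := hw.apply_mem (p := q) (by omega)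
        omega
      · rwa [hw q (by omega)]
    have h4 : p ≤ s → w p = p := fun h => hw p (by omega)
    have h5 : q ≤ s → w q = q := fun h => hw q (by omega)
    split_ifs <;> omega
  · rw [Finset.disjoint_left]
    rintro ⟨p, q⟩ h h'
    rw [mem_inversions] at h h'
    have := hw.inversion_mem h'.2.2.1 h'.2.2.2
    omega

theorem FixesOff.mul_sT_comm {s c i : ℕ} {w : Equiv.Perm ℕ} (hw : FixesOff s c w)
    (hi : i < s) : w * sT i = sT i * w := by
  ext x
  rw [Equiv.Perm.mul_apply, Equiv.Perm.mul_apply]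
  by_cases hx : x ≤ s
  · rw [hw x (by omega)]
    apply hw
    rw [sT_apply]
    split_ifs <;> omega
  · rw [sT_apply_of_ne (p := x) (by omega) (by omega)]
    have h3 : s < w x := by
      by_cases h' : x ≤ s + c
      · have := hw.apply_mem (p := x) (by omega)
        omega
      · rw [hw x (by omega)]
        omega
    rw [sT_apply_of_ne (by omega) (by omega)]

theorem sum_Ico_eq_sum_add_sum {s c : ℕ} {F : ℕ → ℚ} (hF : 1 ≤ s → s < s + c → F s = 0) :
    ∑ i ∈ Finset.Ico 1 (s + c), F i =
      ∑ i ∈ Finset.Ico 1 s, F i + ∑ i ∈ Finset.Ico (s + 1) (s + c), F i := by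
  rw [← Finset.sum_union]
  · refine (Finset.sum_subset (fun i hi => ?_) fun i hi hi' => ?_).symm
    · simp only [Finset.mem_union, Finset.mem_Ico] at hi ⊢
      omega
    · simp only [Finset.mem_union, Finset.mem_Ico] at hi hi'
      obtain rfl : i = s := by omega
      exact hF hi.1 hi.2
  · rw [Finset.disjoint_left]
    intro i hi hi'
    rw [Finset.mem_Ico] at hi hi'
    omega

theorem Upsilon_mul {s c : ℕ} {u w : Equiv.Perm ℕ} {g : MvPolynomial ℕ ℚ} (hu : FixesOff 0 s u)
    (hw : IsSchubert s c w g) :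
    Upsilon (s + c) (u * w) = Upsilon s u * blockValue s c g := by
  obtain ⟨d, hd⟩ : ∃ d, len (s + c) (u * w) = d := ⟨_, rfl⟩
  induction d using Nat.strong_induction_on generalizing u w g with
  | _ d ih =>
    have hlen := hu.len_mul hw.fixesOff
    rcases Nat.eq_zero_or_pos d with rfl | hpos
    · obtain rfl := hw.fixesOff.eq_one_of_len_eq_zero (by omega)
      obtain rfl := hu.eq_one_of_len_eq_zero (by rw [zero_add]; omega)
      rw [hw.unique (isSchubert_one_one s c), mul_one, Upsilon_one, Upsilon_one, blockValue_one,
        mul_one]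
    have hdec : ∀ i, 1 ≤ i → i < s + c → (u * w) (i + 1) < (u * w) i →
        len (s + c) (u * w * sT i) < d := by
      intro i hi hi' h
      have := len_mul_sT_of_gt hi hi' h
      omega
    have hmain := len_mul_Upsilon_eq_sum_ite (s + c) (u * w)
    rw [sum_Ico_eq_sum_add_sum (s := s)] at hmain
    · have h1 : ∑ i ∈ Finset.Ico 1 s, (if (u * w) (i + 1) < (u * w) i then
          (i : ℚ) * Upsilon (s + c) (u * w * sT i) else 0) =
          len s u * Upsilon s u * blockValue s c g := by
        rw [len_mul_Upsilon_eq_sum_ite, Finset.sum_mul]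
        refine Finset.sum_congr rfl fun i hi => ?_
        rw [Finset.mem_Ico] at hi
        have e1 : (u * w) (i + 1) = u (i + 1) := by
          rw [hu.mul_apply hw.fixesOff, if_pos (by omega)]
        have e2 : (u * w) i = u i := by rw [hu.mul_apply hw.fixesOff, if_pos (by omega)]
        have e3 := hdec i hi.1 (by omega)
        have e4 : u * w * sT i = u * sT i * w := by
          rw [mul_assoc, hw.fixesOff.mul_sT_comm hi.2, mul_assoc]
        rw [e1, e2, e4] at e3
        rw [e1, e2, e4]
        split_ifs with h
        · rw [ih _ (e3 h) (hu.mul (fixesOff_sT (by omega) (by omega))) hw rfl, mul_assoc]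
        · rw [zero_mul]
      have h2 : ∑ i ∈ Finset.Ico (s + 1) (s + c), (if (u * w) (i + 1) < (u * w) i then
          (i : ℚ) * Upsilon (s + c) (u * w * sT i) else 0) =
          Upsilon s u * (len (s + c) w * blockValue s c g) := by
        rw [mul_blockValue hw.mem_staircaseSpan, Finset.mul_sum]
        refine Finset.sum_congr rfl fun i hi => ?_
        rw [Finset.mem_Ico] at hi
        have e1 : (u * w) (i + 1) = w (i + 1) := by
          rw [hu.mul_apply hw.fixesOff, if_neg (by omega)]
        have e2 : (u * w) i = w i := by rw [hu.mul_apply hw.fixesOff, if_neg (by omega)]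
        have e3 := hdec i (by omega) hi.2
        rw [e1, e2, mul_assoc] at e3
        rw [e1, e2, mul_assoc]
        split_ifs with h
        · rw [ih _ (e3 h) hu (hw.step hi.1 hi.2 h) rfl]
          ring
        · have h' : w i < w (i + 1) :=
            lt_of_le_of_ne (not_lt.1 h) fun h1 => by
              have := w.injective h1
              omega
          rw [hw.divDiff_eq_zero hi.1 hi.2 h', blockValue, zero_mul, map_zero, mul_zero, mul_zero]
      rw [h1, h2, hlen] at hmain
      have hne : ((len s u + len (s + c) w : ℕ) : ℚ) ≠ 0 := by
        rw [Nat.cast_ne_zero]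
        omega
      refine mul_left_cancel₀ hne (hmain.trans ?_)
      push_cast
      ring
    · intro hs hsc
      rw [if_neg]
      rw [hu.mul_apply hw.fixesOff, hu.mul_apply hw.fixesOff, if_neg (by omega), if_pos le_rfl]
      have h1 := hu.apply_mem (p := s) (by omega)
      have h2 := hw.fixesOff.apply_mem (p := s + 1) (by omega)
      omega

/-- The factor contributed to the principal specialization of a layered permutation by the block
`{s + 1, …, s + c}`. -/
noncomputable def layerFactor (s c : ℕ) : ℚ :=
  blockValue s c (MvPolynomial.monomial (staircase s c) 1)

theorem layeredPerm_append (b : List ℕ) (c : ℕ) :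
    layeredPerm (b ++ [c]) = layeredPerm b * blockRev b.sum c := by
  rw [layeredPerm, List.length_append, List.length_singleton, List.range_succ, List.map_append,
    List.prod_append, List.map_singleton, List.prod_singleton, layeredPerm]
  congr 1
  · congr 1
    refine List.map_congr_left fun j hj => ?_
    rw [List.mem_range] at hj
    rw [List.take_append_of_le_length hj.le, List.getD_append _ _ _ _ hj]
  · simp

theorem fixesOff_layeredPerm (b : List ℕ) : FixesOff 0 b.sum (layeredPerm b) := by
  induction b using List.reverseRecOn with
  | nil => exact FixesOff.one _ _
  | append_singleton b c ih =>
    rw [layeredPerm_append, List.sum_append, List.sum_singleton]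
    refine FixesOff.mul (fun p hp => ih p (by omega)) fun p hp => ?_
    exact fixesOff_blockRev _ _ p (by omega)

theorem Upsilon_layeredPerm_append (b : List ℕ) (c : ℕ) :
    Upsilon (b ++ [c]).sum (layeredPerm (b ++ [c])) =
      Upsilon b.sum (layeredPerm b) * layerFactor b.sum c := by
  rw [layeredPerm_append, List.sum_append, List.sum_singleton, layerFactor,
    Upsilon_mul (fixesOff_layeredPerm b) IsSchubert.top]

open Polynomial in
/-- The column polynomials of the determinant computing `layerFactor`. -/
noncomputable def layerPoly (y r q : ℕ) : ℚ[X] :=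
  (∏ k ∈ Finset.range q, (C 2 * X - C (k : ℚ))) *
    ∏ k ∈ Finset.range (r - q), (X + C ((y : ℚ) - q - k))

open Polynomial in
theorem eval_layerPoly (y r q : ℕ) (x : ℚ) : (layerPoly y r q).eval x =
    (∏ k ∈ Finset.range q, (2 * x - k)) * ∏ k ∈ Finset.range (r - q), (x + (y - q - k)) := by
  simp [layerPoly, eval_prod]

open Polynomial in
theorem natDegree_layerPoly_le (y : ℕ) {r q : ℕ} (hq : q ≤ r) :
    (layerPoly y r q).natDegree ≤ r := by
  have h1 : (∏ k ∈ Finset.range q, (C 2 * X - C (k : ℚ)) : ℚ[X]).natDegree ≤ q := by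
    refine (natDegree_prod_le _ _).trans ?_
    refine (Finset.sum_le_card_nsmul _ _ 1 fun k _ => ?_).trans (by simp)
    compute_degree
  have h2 : (∏ k ∈ Finset.range (r - q), (X + C ((y : ℚ) - q - k)) : ℚ[X]).natDegree ≤ r - q := by
    refine (natDegree_prod_le _ _).trans ?_
    refine (Finset.sum_le_card_nsmul _ _ 1 fun k _ => ?_).trans (by simp)
    rw [natDegree_X_add_C]
  exact natDegree_mul_le.trans ((add_le_add h1 h2).trans (by omega))

theorem prod_range_sub_eq_descFactorial (n k : ℕ) :
    ∏ j ∈ Finset.range k, ((n : ℚ) - j) = n.descFactorial k := by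
  rw [← descPochhammer_eval_eq_prod_range, descPochhammer_eval_eq_descFactorial]

theorem choose_mul_factorial_eq {y r p q : ℕ} (hy : r ≤ y) (hp : p ≤ r) (hq : q ≤ r) :
    (y + p - q).choose (y - p) * ((2 * p).factorial * (y - p).factorial) =
      (2 * p).descFactorial q * (y + p - q).descFactorial (r - q) * (y + p - r).factorial := by
  rcases le_or_gt q (2 * p) with h | h
  · have h1 := Nat.factorial_mul_descFactorial h
    have h2 := Nat.factorial_mul_descFactorial (n := y + p - q) (k := r - q) (by omega)
    have h3 := Nat.choose_mul_factorial_mul_factorial (n := y + p - q) (k := y - p) (by omega)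
    rw [show y + p - q - (r - q) = y + p - r by omega] at h2
    rw [show y + p - q - (y - p) = 2 * p - q by omega] at h3
    rw [mul_assoc, mul_comm ((y + p - q).descFactorial _), h2, ← h3, ← h1]
    ring
  · rw [Nat.choose_eq_zero_of_lt (by omega), Nat.descFactorial_eq_zero_iff_lt.2 h]
    simp

theorem choose_eq_mul_eval_layerPoly {y r p q : ℕ} (hy : r ≤ y) (hp : p ≤ r) (hq : q ≤ r) :
    ((y + p - q).choose (y - p) : ℚ) =
      ((y + p - r).factorial / ((2 * p).factorial * (y - p).factorial)) *
        (layerPoly y r q).eval (p : ℚ) := by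
  have h1 : ∏ k ∈ Finset.range q, (2 * (p : ℚ) - k) = (2 * p).descFactorial q := by
    rw [← prod_range_sub_eq_descFactorial]
    push_cast
    rfl
  have h2 : ∏ k ∈ Finset.range (r - q), ((p : ℚ) + (y - q - k)) =
      (y + p - q).descFactorial (r - q) := by
    rw [← prod_range_sub_eq_descFactorial, Nat.cast_sub (by omega)]
    refine Finset.prod_congr rfl fun k _ => ?_
    push_cast
    ring
  have h3 := congrArg (Nat.cast (R := ℚ)) (choose_mul_factorial_eq hy hp hq)
  push_cast at h3
  have h4 : ((2 * p).factorial : ℚ) ≠ 0 := Nat.cast_ne_zero.2 (Nat.factorial_ne_zero _)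
  have h5 : ((y - p).factorial : ℚ) ≠ 0 := Nat.cast_ne_zero.2 (Nat.factorial_ne_zero _)
  rw [eval_layerPoly, h1, h2, div_mul_eq_mul_div, eq_div_iff (mul_ne_zero h4 h5)]
  linear_combination h3

open Polynomial in
theorem det_eval_eq_det_vandermonde_mul {r : ℕ} {T : ℕ → ℚ[X]} (hT : ∀ q ≤ r, (T q).natDegree ≤ r)
    (x : ℕ → ℚ) : (Matrix.of fun p q : Fin (r + 1) => (T q).eval (x p)).det =
      (Matrix.vandermonde fun p : Fin (r + 1) => x p).det *
        (Matrix.of fun k q : Fin (r + 1) => (T q).coeff k).det := by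
  rw [← Matrix.det_mul]
  congr 1
  ext p q
  rw [Matrix.of_apply, Matrix.mul_apply,
    eval_eq_sum_range' (n := r + 1) (by have := hT q (by omega); omega), Finset.sum_range]
  refine Finset.sum_congr rfl fun k _ => ?_
  rw [Matrix.vandermonde_apply, Matrix.of_apply, mul_comm]

theorem det_eval_layerPoly_mul (y r : ℕ) :
    (Matrix.of fun p q : Fin (r + 1) => (layerPoly y r q).eval ((p : ℕ) : ℚ)).det *
        ∏ i ∈ Finset.range (r + 1), (1 / 2 : ℚ) ^ i =
      ∏ i ∈ Finset.range (r + 1), ((i.factorial : ℚ) *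
        ∏ k ∈ Finset.range (r - i), ((i : ℚ) / 2 + (y - i - k))) := by
  have h1 := det_eval_eq_det_vandermonde_mul (T := layerPoly y r)
    (fun q hq => natDegree_layerPoly_le y hq)
  have h2 : (Matrix.vandermonde fun p : Fin (r + 1) => ((p : ℕ) : ℚ) / 2).det =
      (∏ i ∈ Finset.range (r + 1), (1 / 2 : ℚ) ^ i) *
        (Matrix.vandermonde fun p : Fin (r + 1) => ((p : ℕ) : ℚ)).det := by
    rw [Finset.prod_range, ← Matrix.det_mul_row]
    congr 1
    ext p q
    rw [Matrix.vandermonde_apply, Matrix.of_apply, Matrix.vandermonde_apply, div_pow, div_pow,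
      one_pow]
    ring
  have h3 := h1 fun p => (p : ℚ) / 2
  rw [h2, Matrix.det_of_isLowerTriangular] at h3
  · rw [h1 fun p => (p : ℚ)]
    rw [Finset.prod_range (n := r + 1) (f := fun i => ((i.factorial : ℚ) *
        ∏ k ∈ Finset.range (r - i), ((i : ℚ) / 2 + (y - i - k))))]
    have h4 : ∀ i : Fin (r + 1), (Matrix.of fun p q : Fin (r + 1) =>
        (layerPoly y r q).eval (((p : ℕ) : ℚ) / 2)) i i = ((i : ℕ).factorial : ℚ) *
        ∏ k ∈ Finset.range (r - i), (((i : ℕ) : ℚ) / 2 + (y - (i : ℕ) - k)) := by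
      intro i
      rw [Matrix.of_apply, eval_layerPoly, mul_div_cancel₀ _ (two_ne_zero' ℚ),
        prod_range_sub_eq_descFactorial, Nat.descFactorial_self]
    rw [← Finset.prod_congr rfl fun i _ => h4 i, h3]
    ring
  · intro p q hpq
    have h : (p : ℕ) < q := hpq
    rw [Matrix.of_apply, eval_layerPoly, mul_div_cancel₀ _ (two_ne_zero' ℚ),
      prod_range_sub_eq_descFactorial, Nat.descFactorial_eq_zero_iff_lt.2 h]
    simp

theorem layerFactor_zero (s : ℕ) : layerFactor s 0 = 1 := by
  rw [layerFactor, blockValue_staircase, Matrix.det_isEmpty]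

theorem layerFactor_eq_prod (s r : ℕ) : layerFactor s (r + 1) =
    ∏ i ∈ Finset.range (r + 1), ((i.factorial : ℚ) / (2 * i).factorial *
      ∏ k ∈ Finset.range (r - i), ((2 * s + i + 2 * k + 2 : ℕ) : ℚ)) := by
  have h1 : layerFactor s (r + 1) = (Matrix.of fun p q : Fin (r + 1) =>
      (((s + r + p - r : ℕ).factorial : ℚ) / ((2 * p : ℕ).factorial * (s + r - p : ℕ).factorial)) *
        (Matrix.of fun p q : Fin (r + 1) =>
          (layerPoly (s + r) r q).eval ((p : ℕ) : ℚ)) p q).det := by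
    rw [layerFactor, blockValue_staircase, ← Matrix.det_submatrix_equiv_self Fin.revPerm]
    congr 1
    ext p q
    rw [Matrix.submatrix_apply, Matrix.of_apply, Matrix.of_apply, Matrix.of_apply,
      ← choose_eq_mul_eval_layerPoly (by omega) (by omega) (by omega), Fin.revPerm_apply,
      Fin.revPerm_apply, Fin.val_rev, Fin.val_rev]
    congr 2 <;> omega
  have h2 := det_eval_layerPoly_mul (s + r) r
  have h3 : ∏ p ∈ Finset.range (r + 1), ((s + r + p - r : ℕ).factorial : ℚ) =
      ∏ p ∈ Finset.range (r + 1), ((s + r - p : ℕ).factorial : ℚ) := by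
    rw [← Finset.prod_range_reflect]
    refine Finset.prod_congr rfl fun p hp => ?_
    rw [Finset.mem_range] at hp
    congr 2
    omega
  have h4 : ∏ i ∈ Finset.range (r + 1), ((i.factorial : ℚ) *
        ∏ k ∈ Finset.range (r - i), ((i : ℚ) / 2 + (((s + r : ℕ) : ℚ) - i - k))) =
      (∏ i ∈ Finset.range (r + 1), ((i.factorial : ℚ) *
        ∏ k ∈ Finset.range (r - i), ((2 * s + i + 2 * k + 2 : ℕ) : ℚ))) *
      ∏ i ∈ Finset.range (r + 1), (1 / 2 : ℚ) ^ i := by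
    rw [← Finset.prod_range_reflect (fun i => (1 / 2 : ℚ) ^ i), ← Finset.prod_mul_distrib]
    refine Finset.prod_congr rfl fun i hi => ?_
    rw [Finset.mem_range] at hi
    rw [show r + 1 - 1 - i = r - i by omega, mul_assoc]
    congr 1
    have h5 : (1 / 2 : ℚ) ^ (r - i) = ∏ _k ∈ Finset.range (r - i), (1 / 2 : ℚ) := by
      rw [Finset.prod_const, Finset.card_range]
    rw [h5, ← Finset.prod_mul_distrib, ← Finset.prod_range_reflect]
    refine Finset.prod_congr rfl fun k hk => ?_
    rw [Finset.mem_range] at hk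
    rw [show r - i - 1 - k = r - (i + 1 + k) by omega, Nat.cast_sub (by omega)]
    push_cast
    ring
  have h6 : ∏ i ∈ Finset.range (r + 1), (1 / 2 : ℚ) ^ i ≠ 0 :=
    Finset.prod_ne_zero_iff.2 fun i _ => by positivity
  have h7 : ∏ p ∈ Finset.range (r + 1), ((s + r - p : ℕ).factorial : ℚ) ≠ 0 :=
    Finset.prod_ne_zero_iff.2 fun i _ => by positivity
  rw [h1, Matrix.det_mul_column, mul_right_cancel₀ h6 (h2.trans h4),
    ← Finset.prod_range (fun p => ((s + r + p - r : ℕ).factorial : ℚ) /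
      ((2 * p : ℕ).factorial * (s + r - p : ℕ).factorial)),
    Finset.prod_div_distrib, Finset.prod_mul_distrib, h3, Finset.prod_mul_distrib,
    Finset.prod_mul_distrib, Finset.prod_div_distrib]
  field_simp

theorem layerFactor_succ (s c : ℕ) : layerFactor s (c + 1) = layerFactor s c *
    ∏ i ∈ Finset.range c, ((2 * s + c + 1 + i : ℕ) / (c + 1 + i : ℕ) : ℚ) := by
  cases c with
  | zero =>
    rw [layerFactor_zero, layerFactor_eq_prod]
    simp
  | succ r =>
    rw [layerFactor_eq_prod, layerFactor_eq_prod, Finset.prod_range_succ]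
    have h1 : ∏ i ∈ Finset.range (r + 1), ((i.factorial : ℚ) / (2 * i).factorial *
        ∏ k ∈ Finset.range (r + 1 - i), ((2 * s + i + 2 * k + 2 : ℕ) : ℚ)) =
        (∏ i ∈ Finset.range (r + 1), ((i.factorial : ℚ) / (2 * i).factorial *
          ∏ k ∈ Finset.range (r - i), ((2 * s + i + 2 * k + 2 : ℕ) : ℚ))) *
        ∏ i ∈ Finset.range (r + 1), ((2 * s + (r + 1) + 1 + i : ℕ) : ℚ) := by
      rw [← Finset.prod_range_reflect (fun i => ((2 * s + (r + 1) + 1 + i : ℕ) : ℚ)),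
        ← Finset.prod_mul_distrib]
      refine Finset.prod_congr rfl fun i hi => ?_
      rw [Finset.mem_range] at hi
      rw [show r + 1 - i = r - i + 1 by omega, Finset.prod_range_succ, ← mul_assoc]
      congr 2
      omega
    have h2 : ((r + 1).factorial : ℚ) * ∏ i ∈ Finset.range (r + 1), ((r + 1 + 1 + i : ℕ) : ℚ) =
        (2 * (r + 1)).factorial := by
      rw [← Nat.cast_prod, ← Nat.ascFactorial_eq_prod_range, ← Nat.cast_mul,
        Nat.factorial_mul_ascFactorial]
      congr 2
      omega
    rw [h1, Nat.sub_self, Finset.range_zero, Finset.prod_empty, mul_one, Finset.prod_div_distrib,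
      mul_assoc, ← h2]
    have h3 : ((r + 1).factorial : ℚ) ≠ 0 := Nat.cast_ne_zero.2 (Nat.factorial_ne_zero _)
    congr 1
    rw [div_mul_eq_div_div, div_self h3]
    ring

theorem layerFactor_pos (s c : ℕ) : 0 < layerFactor s c := by
  induction c with
  | zero => rw [layerFactor_zero]; exact one_pos
  | succ c ih =>
    rw [layerFactor_succ]
    exact mul_pos ih (Finset.prod_pos fun i _ => by positivity)

/-- The logarithm of the ratio `(2 s + t) / t`. -/
noncomputable def logRatio (s t : ℝ) : ℝ := Real.log (2 * s + t) - Real.log t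

/-- A primitive of `logRatio s`. -/
noncomputable def logRatioPrim (s t : ℝ) : ℝ :=
  (2 * s + t) * Real.log (2 * s + t) - t * Real.log t

/-- The continuous approximation `(s + t) ^ 2 * f (s / (s + t))` of the logarithm of
`layerFactor s t`. -/
noncomputable def layerProfile (s t : ℝ) : ℝ :=
  s ^ 2 * Real.log s - 1 / 2 * (t ^ 2 * Real.log t) -
    1 / 2 * ((2 * s + t) ^ 2 * Real.log (2 * s + t)) + (s + t) ^ 2 * Real.log (s + t) +
    2 * s * (s + t) * Real.log 2

theorem log_layerFactor_succ (s c : ℕ) :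
    Real.log (layerFactor s (c + 1) : ℚ) = Real.log (layerFactor s c : ℚ) +
      ∑ i ∈ Finset.range c, logRatio s (c + 1 + i) := by
  rw [layerFactor_succ]
  push_cast
  rw [Real.log_mul, Real.log_prod]
  · congr 1
    refine Finset.sum_congr rfl fun i _ => ?_
    rw [Real.log_div (by positivity) (by positivity), logRatio]
    congr 2
    ring
  · exact fun i _ => by positivity
  · exact_mod_cast (layerFactor_pos s c).ne'
  · exact Finset.prod_ne_zero_iff.2 fun i _ => by positivity

theorem logRatio_nonneg {s t : ℝ} (hs : 0 ≤ s) (ht : 0 < t) : 0 ≤ logRatio s t :=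
  sub_nonneg.2 (Real.log_le_log ht (by linarith))

theorem logRatio_anti {s t u : ℝ} (hs : 0 ≤ s) (ht : 0 < t) (htu : t ≤ u) :
    logRatio s u ≤ logRatio s t := by
  have hu : 0 < u := ht.trans_le htu
  rw [logRatio, logRatio, ← Real.log_div (by positivity) (by positivity),
    ← Real.log_div (by positivity) (by positivity)]
  refine Real.log_le_log (by positivity) ?_
  rw [div_le_div_iff₀ hu ht]
  nlinarith

theorem hasDerivAt_logRatioPrim {s t : ℝ} (hs : 0 ≤ s) (ht : 0 < t) :
    HasDerivAt (logRatioPrim s) (logRatio s t) t := by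
  have h1 : HasDerivAt (fun t : ℝ => 2 * s + t) 1 t := (hasDerivAt_id t).const_add _
  have h2 := (Real.hasDerivAt_mul_log (x := 2 * s + t) (by positivity)).comp t h1
  have h3 := h2.sub (Real.hasDerivAt_mul_log ht.ne')
  refine h3.congr_deriv ?_
  rw [logRatio]
  ring

theorem exists_logRatioPrim_sub_eq {s t : ℝ} (hs : 0 ≤ s) (ht : 0 < t) :
    ∃ ξ ∈ Set.Ioo t (t + 1), logRatioPrim s (t + 1) - logRatioPrim s t = logRatio s ξ := by
  obtain ⟨ξ, hξ, h⟩ := exists_hasDerivAt_eq_slope (logRatioPrim s) (logRatio s)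
    (show t < t + 1 by linarith)
    (fun x hx => (hasDerivAt_logRatioPrim hs (ht.trans_le hx.1)).continuousAt.continuousWithinAt)
    (fun x hx => hasDerivAt_logRatioPrim hs (ht.trans hx.1))
  refine ⟨ξ, hξ, ?_⟩
  rw [h]
  simp

theorem logRatioPrim_two_mul_sub_eq_sum (s : ℝ) (c : ℕ) :
    logRatioPrim s (2 * c) - logRatioPrim s c =
      ∑ i ∈ Finset.range c, (logRatioPrim s (c + i + 1) - logRatioPrim s (c + i)) := by
  have h := Finset.sum_range_sub (fun i : ℕ => logRatioPrim s (c + i)) c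
  simp only [Nat.cast_zero, add_zero, Nat.cast_add, Nat.cast_one, ← add_assoc] at h
  rw [h, two_mul]

theorem hasDerivAt_sq_mul_log {t : ℝ} (ht : t ≠ 0) :
    HasDerivAt (fun t : ℝ => t ^ 2 * Real.log t) (2 * t * Real.log t + t) t := by
  refine ((hasDerivAt_pow 2 t).mul (Real.hasDerivAt_log ht)).congr_deriv ?_
  field_simp
  ring

theorem continuous_sq_mul_log : Continuous fun t : ℝ => t ^ 2 * Real.log t := by
  have h := continuous_id.mul Real.continuous_mul_log
  refine h.congr fun t => ?_
  change t * (t * Real.log t) = t ^ 2 * Real.log t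
  ring

theorem continuous_layerProfile (s : ℝ) : Continuous (layerProfile s) := by
  unfold layerProfile
  have h1 := continuous_sq_mul_log
  have h2 : Continuous fun t : ℝ => (2 * s + t) ^ 2 * Real.log (2 * s + t) :=
    h1.comp (continuous_const.add continuous_id)
  have h3 : Continuous fun t : ℝ => (s + t) ^ 2 * Real.log (s + t) :=
    h1.comp (continuous_const.add continuous_id)
  fun_prop

theorem hasDerivAt_layerProfile {s t : ℝ} (hs : 0 ≤ s) (ht : 0 < t) :
    HasDerivAt (layerProfile s) (logRatioPrim s (2 * t) - logRatioPrim s t) t := by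
  have h1 : HasDerivAt (fun t : ℝ => 2 * s + t) 1 t := (hasDerivAt_id t).const_add _
  have h1' : HasDerivAt (fun t : ℝ => s + t) 1 t := (hasDerivAt_id t).const_add _
  have h2 := (hasDerivAt_sq_mul_log (t := 2 * s + t) (by positivity)).comp t h1
  have h3 := (hasDerivAt_sq_mul_log (t := s + t) (by positivity)).comp t h1'
  have h4 := ((((hasDerivAt_const t (s ^ 2 * Real.log s)).sub
    ((hasDerivAt_sq_mul_log ht.ne').const_mul (1 / 2))).sub (h2.const_mul (1 / 2))).add h3).add
    ((h1'.const_mul (2 * s)).mul_const (Real.log 2))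
  refine h4.congr_deriv ?_
  rw [logRatioPrim, logRatioPrim, show 2 * s + 2 * t = 2 * (s + t) by ring,
    Real.log_mul two_ne_zero (by positivity), Real.log_mul two_ne_zero ht.ne']
  ring

theorem logRatioPrim_two_mul_sub_mono {s t u : ℝ} (hs : 0 ≤ s) (ht : 0 < t) (htu : t ≤ u) :
    logRatioPrim s (2 * t) - logRatioPrim s t ≤ logRatioPrim s (2 * u) - logRatioPrim s u := by
  have hd : ∀ x : ℝ, 0 < x → HasDerivAt (fun t => logRatioPrim s (2 * t) - logRatioPrim s t)
      (logRatio s (2 * x) * 2 - logRatio s x) x := by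
    intro x hx
    have h1 : HasDerivAt (fun t : ℝ => 2 * t) 2 x := by
      simpa using (hasDerivAt_id x).const_mul 2
    exact ((hasDerivAt_logRatioPrim hs (by positivity : (0 : ℝ) < 2 * x)).comp x h1).sub
      (hasDerivAt_logRatioPrim hs hx)
  have hm : MonotoneOn (fun t => logRatioPrim s (2 * t) - logRatioPrim s t) (Set.Ioi 0) := by
    refine monotoneOn_of_deriv_nonneg (convex_Ioi 0)
      (fun x hx => (hd x hx).continuousAt.continuousWithinAt)
      (fun x hx => (hd x (interior_subset hx)).differentiableAt.differentiableWithinAt)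
      fun x hx => ?_
    have hx' : 0 < x := interior_subset hx
    rw [(hd x hx').deriv, logRatio, logRatio, show 2 * s + 2 * x = 2 * (s + x) by ring,
      Real.log_mul two_ne_zero (by positivity), Real.log_mul two_ne_zero hx'.ne']
    have h2 : Real.log (x * (2 * s + x)) ≤ Real.log ((s + x) ^ 2) :=
      Real.log_le_log (by positivity) (by nlinarith)
    rw [Real.log_mul hx'.ne' (by positivity), Real.log_pow] at h2
    push_cast at h2
    linarith
  exact hm ht (ht.trans_le htu) htu

theorem exists_layerProfile_sub_eq {s t : ℝ} (hs : 0 ≤ s) (ht : 0 ≤ t) :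
    ∃ ξ ∈ Set.Ioo t (t + 1), layerProfile s (t + 1) - layerProfile s t =
      logRatioPrim s (2 * ξ) - logRatioPrim s ξ := by
  obtain ⟨ξ, hξ, h⟩ := exists_hasDerivAt_eq_slope (layerProfile s)
    (fun t => logRatioPrim s (2 * t) - logRatioPrim s t) (show t < t + 1 by linarith)
    (continuous_layerProfile s).continuousOn
    (fun x hx => hasDerivAt_layerProfile hs (ht.trans_lt hx.1))
  refine ⟨ξ, hξ, ?_⟩
  rw [h]
  simp

theorem logRatioPrim_mono {s t u : ℝ} (hs : 0 ≤ s) (ht : 0 < t) (htu : t ≤ u) :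
    logRatioPrim s t ≤ logRatioPrim s u := by
  have hm : MonotoneOn (logRatioPrim s) (Set.Ioi 0) := by
    refine monotoneOn_of_deriv_nonneg (convex_Ioi 0)
      (fun x hx => (hasDerivAt_logRatioPrim hs hx).continuousAt.continuousWithinAt)
      (fun x hx => (hasDerivAt_logRatioPrim hs
        (interior_subset hx)).differentiableAt.differentiableWithinAt) fun x hx => ?_
    have hx' : 0 < x := interior_subset hx
    rw [(hasDerivAt_logRatioPrim hs hx').deriv]
    exact logRatio_nonneg hs hx'
  exact hm ht (ht.trans_le htu) htu

theorem layerProfile_zero_right {s : ℝ} (hs : 0 ≤ s) : layerProfile s 0 = 0 := by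
  rcases hs.eq_or_lt with rfl | hs
  · simp [layerProfile]
  · rw [layerProfile, add_zero, add_zero, Real.log_mul two_ne_zero hs.ne']
    ring

theorem log_layerFactor_le (s c : ℕ) :
    Real.log (layerFactor s c : ℚ) ≤ layerProfile s c := by
  have hs : (0 : ℝ) ≤ s := Nat.cast_nonneg s
  induction c with
  | zero => rw [layerFactor_zero, Nat.cast_zero, layerProfile_zero_right hs]; simp
  | succ c ih =>
    rw [log_layerFactor_succ]
    obtain ⟨ξ, hξ, h⟩ := exists_layerProfile_sub_eq hs (Nat.cast_nonneg (α := ℝ) c)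
    have h1 : ∑ i ∈ Finset.range c, logRatio s (c + 1 + i) ≤
        logRatioPrim s (2 * ξ) - logRatioPrim s ξ := by
      rcases Nat.eq_zero_or_pos c with rfl | hc
      · have hξ0 : 0 < ξ := by simpa using hξ.1
        have := logRatioPrim_mono hs hξ0 (show ξ ≤ 2 * ξ by linarith)
        simpa using this
      · have hc' : (0 : ℝ) < c := Nat.cast_pos.2 hc
        refine le_trans ?_ (logRatioPrim_two_mul_sub_mono hs hc' hξ.1.le)
        rw [logRatioPrim_two_mul_sub_eq_sum]
        refine Finset.sum_le_sum fun i _ => ?_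
        have hi : (0 : ℝ) < c + i := by positivity
        obtain ⟨ζ, hζ, h2⟩ := exists_logRatioPrim_sub_eq hs hi
        rw [h2, show (c : ℝ) + 1 + i = c + i + 1 by ring]
        exact logRatio_anti hs (hi.trans hζ.1) hζ.2.le
    push_cast
    linarith

theorem layerProfile_sub_le_log_layerFactor (s c : ℕ) :
    layerProfile s c - ∑ k ∈ Finset.range c, logRatio s (2 * k + 1) ≤
      Real.log (layerFactor s c : ℚ) := by
  have hs : (0 : ℝ) ≤ s := Nat.cast_nonneg s
  induction c with
  | zero => rw [layerFactor_zero, Nat.cast_zero, layerProfile_zero_right hs]; simp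
  | succ c ih =>
    rw [log_layerFactor_succ, Finset.sum_range_succ]
    obtain ⟨ξ, hξ, h⟩ := exists_layerProfile_sub_eq hs (Nat.cast_nonneg (α := ℝ) c)
    have h1 : logRatioPrim s (2 * ξ) - logRatioPrim s ξ ≤
        ∑ i ∈ Finset.range c, logRatio s (c + 1 + i) + logRatio s (2 * c + 1) := by
      have hξ0 : 0 < ξ := (Nat.cast_nonneg c).trans_lt hξ.1
      refine (logRatioPrim_two_mul_sub_mono hs hξ0 hξ.2.le).trans ?_
      have h3 := logRatioPrim_two_mul_sub_eq_sum s (c + 1)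
      push_cast at h3
      rw [h3]
      have h4 : ∑ i ∈ Finset.range c, logRatio s (c + 1 + i) + logRatio s (2 * c + 1) =
          ∑ i ∈ Finset.range (c + 1), logRatio s (c + 1 + i) := by
        rw [Finset.sum_range_succ]
        congr 2
        ring
      rw [h4]
      refine Finset.sum_le_sum fun i _ => ?_
      have hi : (0 : ℝ) < c + 1 + i := by positivity
      obtain ⟨ζ, hζ, h2⟩ := exists_logRatioPrim_sub_eq hs hi
      rw [h2]
      exact logRatio_anti hs hi hζ.1.le
    push_cast
    linarith

theorem sum_logRatio_le (s c : ℕ) : ∑ k ∈ Finset.range (c + 1), logRatio s (2 * k + 1) ≤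
    Real.log (2 * s + 1) + Real.log ((s + c).choose c) := by
  induction c with
  | zero => simp [logRatio]
  | succ c ih =>
    rw [Finset.sum_range_succ]
    have hpos : (0 : ℝ) < (s + c).choose c := Nat.cast_pos.2 (Nat.choose_pos (by omega))
    have h1 : ((s + (c + 1)).choose (c + 1) : ℝ) =
        (s + c).choose c * ((s + c + 1) / (c + 1)) := by
      have h := Nat.add_one_mul_choose_eq (s + c) c
      have h' := congrArg (Nat.cast (R := ℝ)) h
      push_cast at h'
      rw [← mul_div_assoc, eq_div_iff (by positivity), ← add_assoc]
      linarith
    have h2 : logRatio s (2 * (c + 1 : ℕ) + 1) ≤ Real.log ((s + c + 1) / (c + 1)) := by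
      rw [logRatio, ← Real.log_div (by positivity) (by positivity)]
      refine Real.log_le_log (by positivity) ?_
      rw [div_le_div_iff₀ (by positivity) (by positivity)]
      push_cast
      nlinarith [Nat.cast_nonneg (α := ℝ) s, Nat.cast_nonneg (α := ℝ) c]
    rw [h1, Real.log_mul hpos.ne' (by positivity)]
    linarith

theorem layerProfile_eq {s t : ℝ} (hs : 0 ≤ s) (ht : 0 ≤ t) (hst : 0 < s + t) :
    layerProfile s t = (s + t) ^ 2 * f (s / (s + t)) := by
  have h1 : 1 - s / (s + t) = t / (s + t) := by field_simp; ring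
  have h2 : 1 + s / (s + t) = (2 * s + t) / (s + t) := by field_simp; ring
  have hlog : ∀ x : ℝ, 0 ≤ x →
      (x / (s + t)) ^ 2 * Real.log (x / (s + t)) =
        (x ^ 2 * Real.log x - x ^ 2 * Real.log (s + t)) / (s + t) ^ 2 := by
    intro x hx
    rcases hx.eq_or_lt with rfl | hx
    · simp
    · rw [Real.log_div hx.ne' hst.ne', div_pow]
      ring
  rw [f, h1, h2, mul_assoc (1 / 2), mul_assoc (1 / 2), hlog s hs, hlog t ht,
    hlog (2 * s + t) (by linarith), layerProfile]
  field_simp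
  ring

/-- The derivative of `f` on `(0, 1)`, extended continuously to `[0, 1]`. -/
noncomputable def fDeriv (x : ℝ) : ℝ :=
  2 * (x * Real.log x) + (1 - x) * Real.log (1 - x) - (1 + x) * Real.log (1 + x) +
    2 * Real.log 2

theorem hasDerivAt_f {x : ℝ} (hx : x ∈ Set.Ioo (0 : ℝ) 1) : HasDerivAt f (fDeriv x) x := by
  obtain ⟨h0, h1⟩ := hx
  have hs : HasDerivAt (fun t : ℝ => 1 - t) (-1) x := (hasDerivAt_id x).const_sub 1
  have ha : HasDerivAt (fun t : ℝ => 1 + t) 1 x := (hasDerivAt_id x).const_add 1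
  have h2 := (hasDerivAt_sq_mul_log (t := 1 - x) (by linarith)).comp x hs
  have h3 := (hasDerivAt_sq_mul_log (t := 1 + x) (by linarith)).comp x ha
  have h4 := (((hasDerivAt_sq_mul_log h0.ne').sub (h2.const_mul (1 / 2))).sub
    (h3.const_mul (1 / 2))).add (((hasDerivAt_id x).const_mul 2).mul_const (Real.log 2))
  refine (h4.congr_of_eventuallyEq (.of_eq ?_)).congr_deriv ?_
  · funext t
    simp only [f, Function.comp, Pi.add_apply, Pi.sub_apply, id]
    ring
  · rw [fDeriv]
    ring

theorem hasDerivAt_fDeriv {x : ℝ} (hx : x ∈ Set.Ioo (0 : ℝ) 1) :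
    HasDerivAt fDeriv (2 * Real.log x - Real.log (1 - x) - Real.log (1 + x)) x := by
  obtain ⟨h0, h1⟩ := hx
  have hs : HasDerivAt (fun t : ℝ => 1 - t) (-1) x := (hasDerivAt_id x).const_sub 1
  have ha : HasDerivAt (fun t : ℝ => 1 + t) 1 x := (hasDerivAt_id x).const_add 1
  have h2 := (Real.hasDerivAt_mul_log (x := 1 - x) (by linarith)).comp x hs
  have h3 := (Real.hasDerivAt_mul_log (x := 1 + x) (by linarith)).comp x ha
  have h4 := ((((Real.hasDerivAt_mul_log h0.ne').const_mul 2).add h2).sub h3).add_const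
    (2 * Real.log 2)
  refine h4.congr_deriv ?_
  ring

theorem continuous_fDeriv : Continuous fDeriv := by
  have h1 := Real.continuous_mul_log
  have h2 : Continuous fun t : ℝ => (1 - t) * Real.log (1 - t) :=
    h1.comp (continuous_const.sub continuous_id)
  have h3 : Continuous fun t : ℝ => (1 + t) * Real.log (1 + t) :=
    h1.comp (continuous_const.add continuous_id)
  exact (((h1.const_mul 2).add h2).sub h3).add continuous_const

theorem continuous_f : Continuous f := by
  have h1 := continuous_sq_mul_log
  have h2 : Continuous fun t : ℝ => (1 - t) ^ 2 * Real.log (1 - t) :=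
    h1.comp (continuous_const.sub continuous_id)
  have h3 : Continuous fun t : ℝ => (1 + t) ^ 2 * Real.log (1 + t) :=
    h1.comp (continuous_const.add continuous_id)
  unfold f
  simp only [mul_assoc]
  fun_prop

theorem f_zero : f 0 = 0 := by simp [f]

theorem f_le {x : ℝ} (hx : x ∈ Set.Ioo (0 : ℝ) 1) : f x ≤ 2 * Real.log 2 * x := by
  obtain ⟨h0, h1⟩ := hx
  have hlog : ∀ y : ℝ, 0 < y → y - 1 ≤ y * Real.log y := by
    intro y hy
    have h := mul_le_mul_of_nonneg_left (Real.one_sub_inv_le_log_of_pos hy) hy.le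
    rwa [mul_sub, mul_one, mul_inv_cancel₀ hy.ne'] at h
  have h2 := mul_le_mul_of_nonneg_left (hlog (1 - x) (by linarith)) (show 0 ≤ 1 - x by linarith)
  have h3 := mul_le_mul_of_nonneg_left (hlog (1 + x) (by linarith)) (show 0 ≤ 1 + x by linarith)
  have h4 := mul_nonpos_of_nonneg_of_nonpos (sq_nonneg x) (Real.log_nonpos h0.le h1.le)
  rw [f]
  nlinarith

/-- Up to the positive factor `(1 - x ^ 2) ^ 2`, the derivative of `f x / (1 - x ^ 2)`. -/
noncomputable def ratioDeriv (x : ℝ) : ℝ := 2 * x * f x + (1 - x ^ 2) * fDeriv x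

theorem continuous_ratioDeriv : Continuous ratioDeriv := by
  have h1 := continuous_f
  have h2 := continuous_fDeriv
  unfold ratioDeriv
  fun_prop

theorem ratioDeriv_zero_pos : 0 < ratioDeriv 0 := by
  have := Real.log_pos one_lt_two
  simp [ratioDeriv, fDeriv, this]

theorem ratioDeriv_half_neg : ratioDeriv (1 / 2) < 0 := by
  have h1 : Real.log (1 / 2 : ℝ) = -Real.log 2 := by rw [one_div, Real.log_inv]
  have h2 : Real.log (3 / 2 : ℝ) = Real.log 3 - Real.log 2 :=
    Real.log_div three_ne_zero two_ne_zero
  have h3 : 14 * Real.log 2 < 9 * Real.log 3 := by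
    have h := Real.log_lt_log (by norm_num) (show (2 : ℝ) ^ 14 < 3 ^ 9 by norm_num)
    rw [Real.log_pow, Real.log_pow] at h
    exact_mod_cast h
  rw [ratioDeriv, f, fDeriv, show (1 : ℝ) - 1 / 2 = 1 / 2 by norm_num,
    show (1 : ℝ) + 1 / 2 = 3 / 2 by norm_num, h1, h2]
  linarith

theorem hasDerivAt_f_div {x : ℝ} (hx : x ∈ Set.Ioo (0 : ℝ) 1) :
    HasDerivAt (fun t => f t / (1 - t ^ 2)) (ratioDeriv x / (1 - x ^ 2) ^ 2) x := by
  have h1 : (1 : ℝ) - x ^ 2 ≠ 0 := by nlinarith [hx.1, hx.2]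
  refine ((hasDerivAt_f hx).div ((hasDerivAt_pow 2 x).const_sub 1) h1).congr_deriv ?_
  rw [ratioDeriv]
  ring

theorem lt_half_of_unique {α : ℝ}
    (huniq : ∀ β ∈ Set.Ioo (0 : ℝ) 1, ratioDeriv β = 0 → β = α) : α < 1 / 2 := by
  obtain ⟨β, hβ, h⟩ := intermediate_value_Ioo' (show (0 : ℝ) ≤ 1 / 2 by norm_num)
    continuous_ratioDeriv.continuousOn ⟨ratioDeriv_half_neg, ratioDeriv_zero_pos⟩
  rw [← huniq β ⟨hβ.1, hβ.2.trans (by norm_num)⟩ h]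
  exact hβ.2

theorem ratioDeriv_nonneg {α x : ℝ}
    (huniq : ∀ β ∈ Set.Ioo (0 : ℝ) 1, ratioDeriv β = 0 → β = α) (hx0 : 0 < x) (hxα : x < α) :
    0 ≤ ratioDeriv x := by
  by_contra! h
  obtain ⟨β, hβ, h0⟩ := intermediate_value_Ioo' hx0.le continuous_ratioDeriv.continuousOn
    ⟨h, ratioDeriv_zero_pos⟩
  have h1 := lt_half_of_unique huniq
  have h2 := huniq β ⟨hβ.1, by linarith [hβ.2]⟩ h0
  linarith [hβ.2]

theorem ratioDeriv_nonpos {α x : ℝ} (hα : 0 < α)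
    (huniq : ∀ β ∈ Set.Ioo (0 : ℝ) 1, ratioDeriv β = 0 → β = α) (hαx : α < x) (hx1 : x < 1) :
    ratioDeriv x ≤ 0 := by
  by_contra! h
  obtain ⟨β, hβ, h0⟩ := (isPreconnected_uIcc (a := (1 / 2 : ℝ)) (b := x)).intermediate_value
    Set.left_mem_uIcc Set.right_mem_uIcc continuous_ratioDeriv.continuousOn
    ⟨ratioDeriv_half_neg.le, h.le⟩
  have h1 := lt_half_of_unique huniq
  have h2 : α < β := (lt_min h1 hαx).trans_le hβ.1
  have h3 : β < 1 := hβ.2.trans_lt (max_lt (by norm_num) hx1)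
  exact h2.ne' (huniq β ⟨hα.trans h2, h3⟩ h0)

theorem f_le_of_unique {α x : ℝ} (hα : α ∈ Set.Ioo (0 : ℝ) 1)
    (huniq : ∀ β ∈ Set.Ioo (0 : ℝ) 1, ratioDeriv β = 0 → β = α) (hx : x ∈ Set.Ico (0 : ℝ) 1) :
    f x ≤ f α / (1 - α ^ 2) * (1 - x ^ 2) := by
  have hpos : ∀ y ∈ Set.Ico (0 : ℝ) 1, 0 < 1 - y ^ 2 := fun y hy => by nlinarith [hy.1, hy.2]
  rw [← div_le_iff₀ (hpos x hx)]
  have hc : ContinuousOn (fun t => f t / (1 - t ^ 2)) (Set.Ico 0 1) :=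
    continuous_f.continuousOn.div (by fun_prop) fun y hy => (hpos y hy).ne'
  rcases le_total x α with hxα | hxα
  · have hm : MonotoneOn (fun t => f t / (1 - t ^ 2)) (Set.Icc 0 α) := by
      refine monotoneOn_of_hasDerivWithinAt_nonneg (convex_Icc 0 α)
        (f' := fun y => ratioDeriv y / (1 - y ^ 2) ^ 2)
        (hc.mono (Set.Icc_subset_Ico_right hα.2)) (fun y hy => ?_) fun y hy => ?_
      all_goals rw [interior_Icc] at hy
      · exact (hasDerivAt_f_div ⟨hy.1, hy.2.trans hα.2⟩).hasDerivWithinAt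
      · exact div_nonneg (ratioDeriv_nonneg huniq hy.1 hy.2) (sq_nonneg _)
    exact hm ⟨hx.1, hxα⟩ ⟨hα.1.le, le_rfl⟩ hxα
  · have hm : AntitoneOn (fun t => f t / (1 - t ^ 2)) (Set.Icc α x) := by
      refine antitoneOn_of_hasDerivWithinAt_nonpos (convex_Icc α x)
        (f' := fun y => ratioDeriv y / (1 - y ^ 2) ^ 2)
        (hc.mono fun y hy => ⟨hα.1.le.trans hy.1, hy.2.trans_lt hx.2⟩) (fun y hy => ?_)
        fun y hy => ?_
      all_goals rw [interior_Icc] at hy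
      · exact (hasDerivAt_f_div ⟨hα.1.trans hy.1, hy.2.trans hx.2⟩).hasDerivWithinAt
      · exact div_nonpos_of_nonpos_of_nonneg
          (ratioDeriv_nonpos hα.1 huniq hy.1 (hy.2.trans hx.2)) (sq_nonneg _)
    exact hm ⟨le_rfl, hxα⟩ ⟨hxα, le_rfl⟩ hxα

theorem le_f_of_root {α γ x : ℝ} (hα : α < 1 / 2) (hγ : 0 ≤ γ) (hf : f α = γ * (1 - α ^ 2))
    (hf' : fDeriv α = -2 * γ * α) (hx : 0 < x) (hxα : x < α) :
    γ * (1 - x ^ 2) + 2 * Real.log x * (α - x) ^ 2 ≤ f x := by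
  have hmem : ∀ y, x ≤ y → y ≤ α → y ∈ Set.Ioo (0 : ℝ) 1 := fun y h1 h2 =>
    ⟨hx.trans_le h1, by linarith⟩
  have hd : ∀ y, x ≤ y → y ≤ α →
      HasDerivAt (fun t => f t + γ * t ^ 2) (fDeriv y + 2 * γ * y) y := fun y h1 h2 =>
    ((hasDerivAt_f (hmem y h1 h2)).add ((hasDerivAt_pow 2 y).const_mul γ)).congr_deriv
      (by norm_num; ring)
  have hd' : ∀ y, x ≤ y → y ≤ α → HasDerivAt (fun t => fDeriv t + 2 * γ * t)
      (2 * Real.log y - Real.log (1 - y) - Real.log (1 + y) + 2 * γ) y := fun y h1 h2 =>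
    ((hasDerivAt_fDeriv (hmem y h1 h2)).add ((hasDerivAt_id y).const_mul (2 * γ))).congr_deriv
      (by ring)
  obtain ⟨ξ, hξ, h1⟩ := exists_hasDerivAt_eq_slope (fun t => f t + γ * t ^ 2)
    (fun y => fDeriv y + 2 * γ * y) hxα
    (fun y hy => (hd y hy.1 hy.2).continuousAt.continuousWithinAt)
    (fun y hy => hd y hy.1.le hy.2.le)
  obtain ⟨ζ, hζ, h2⟩ := exists_hasDerivAt_eq_slope (fun t => fDeriv t + 2 * γ * t)
    (fun y => 2 * Real.log y - Real.log (1 - y) - Real.log (1 + y) + 2 * γ) hξ.2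
    (fun y hy => (hd' y (hξ.1.le.trans hy.1) hy.2).continuousAt.continuousWithinAt)
    (fun y hy => hd' y (hξ.1.le.trans hy.1.le) hy.2.le)
  have hxζ : x < ζ := hξ.1.trans hζ.1
  have hζ1 := hmem ζ hxζ.le hζ.2.le
  rw [eq_div_iff (by linarith [hξ.2])] at h1 h2
  have h3 : 2 * Real.log x ≤
      2 * Real.log ζ - Real.log (1 - ζ) - Real.log (1 + ζ) + 2 * γ := by
    have ha := Real.log_le_log hx hxζ.le
    have hb : Real.log ((1 - ζ) * (1 + ζ)) ≤ 0 :=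
      Real.log_nonpos (by nlinarith [hζ1.1, hζ1.2]) (by nlinarith)
    rw [Real.log_mul (by linarith [hζ1.2]) (by linarith [hζ1.1])] at hb
    linarith
  have h4 : Real.log x ≤ 0 := Real.log_nonpos hx.le (by linarith)
  have h5 : 0 ≤ (α - ξ) * (α - x) := mul_nonneg (by linarith [hξ.2]) (by linarith)
  have h6 : (α - ξ) * (α - x) ≤ (α - x) ^ 2 := by nlinarith [hξ.1]
  have h7 := mul_le_mul_of_nonneg_right h3 h5
  have h8 := mul_le_mul_of_nonpos_left h6 h4
  rw [hf, hf'] at *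
  nlinarith

theorem Upsilon_layeredPerm_pos (b : List ℕ) : 0 < Upsilon b.sum (layeredPerm b) := by
  induction b using List.reverseRecOn with
  | nil =>
    rw [show layeredPerm [] = 1 from rfl, Upsilon_one]
    exact one_pos
  | append_singleton b c ih =>
    rw [Upsilon_layeredPerm_append]
    exact mul_pos ih (layerFactor_pos _ _)

theorem log_Upsilon_layeredPerm_append (b : List ℕ) (c : ℕ) :
    Real.log (Upsilon (b ++ [c]).sum (layeredPerm (b ++ [c])) : ℚ) =
      Real.log (Upsilon b.sum (layeredPerm b) : ℚ) + Real.log (layerFactor b.sum c : ℚ) := by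
  rw [Upsilon_layeredPerm_append, Rat.cast_mul, Real.log_mul]
  · exact_mod_cast (Upsilon_layeredPerm_pos b).ne'
  · exact_mod_cast (layerFactor_pos _ _).ne'

theorem log_Upsilon_layeredPerm_le {γ : ℝ}
    (hf : ∀ x ∈ Set.Ico (0 : ℝ) 1, f x ≤ γ * (1 - x ^ 2)) (b : List ℕ) (hb : ∀ c ∈ b, 0 < c) :
    Real.log (Upsilon b.sum (layeredPerm b) : ℚ) ≤ γ * (b.sum : ℝ) ^ 2 := by
  induction b using List.reverseRecOn with
  | nil => rw [show layeredPerm [] = 1 from rfl, Upsilon_one]; simp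
  | append_singleton b c ih =>
    have hc : (0 : ℝ) < c := Nat.cast_pos.2 (hb c (by simp))
    have hs : (0 : ℝ) ≤ b.sum := Nat.cast_nonneg _
    have h1 := ih fun d hd => hb d (List.mem_append_left _ hd)
    have h2 := log_layerFactor_le b.sum c
    have hn : (0 : ℝ) < b.sum + c := by positivity
    rw [layerProfile_eq hs hc.le hn] at h2
    have h3 := mul_le_mul_of_nonneg_left
      (hf (b.sum / (b.sum + c)) ⟨by positivity, (div_lt_one hn).2 (by linarith)⟩)
      (sq_nonneg ((b.sum : ℝ) + c))
    have h4 : ((b.sum : ℝ) + c) ^ 2 * (γ * (1 - (b.sum / (b.sum + c) : ℝ) ^ 2)) =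
        γ * ((b.sum + c) ^ 2 - (b.sum : ℝ) ^ 2) := by
      field_simp
    rw [log_Upsilon_layeredPerm_append, List.sum_append, List.sum_singleton,
      Nat.cast_add]
    linarith

theorem sum_logRatio_le_log_add {s c n : ℕ} (hn : s + c = n) (hs : 2 * s + 1 ≤ n) :
    ∑ k ∈ Finset.range c, logRatio s (2 * k + 1) ≤ Real.log n + n * Real.log 2 := by
  obtain ⟨d, rfl⟩ : ∃ d, c = d + 1 := Nat.exists_eq_add_one.2 (by omega)
  refine (sum_logRatio_le s d).trans (add_le_add ?_ ?_)
  · exact Real.log_le_log (by positivity) (by exact_mod_cast hs)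
  · have hpos : (0 : ℝ) < (s + d).choose d := Nat.cast_pos.2 (Nat.choose_pos (by omega))
    have h1 : ((s + d).choose d : ℝ) ≤ 2 ^ n := by
      have h := (Nat.choose_le_two_pow (s + d) d).trans
        (Nat.pow_le_pow_right two_pos (by omega : s + d ≤ n))
      exact_mod_cast h
    rw [← Real.log_pow]
    exact Real.log_le_log hpos h1

theorem three_mul_log_add_le {n : ℕ} (hn : 0 < n) :
    3 * Real.log n + n * Real.log 2 ≤ 2 * n := by
  have hn' : (0 : ℝ) < n := Nat.cast_pos.2 hn
  have he := Real.exp_one_gt_d9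
  have h1 := Real.log_le_sub_one_of_pos (div_pos hn' (Real.exp_pos 1))
  rw [Real.log_div hn'.ne' (Real.exp_pos 1).ne', Real.log_exp] at h1
  have h2 : (n : ℝ) / Real.exp 1 ≤ n * 0.4 := by
    rw [div_le_iff₀ (Real.exp_pos 1)]
    nlinarith
  nlinarith [Real.log_two_lt_d9]

theorem layerFactor_zero_left (c : ℕ) : layerFactor 0 c = 1 := by
  induction c with
  | zero => exact layerFactor_zero 0
  | succ c ih =>
    rw [layerFactor_succ, ih, one_mul]
    refine Finset.prod_eq_one fun i _ => ?_
    rw [Nat.mul_zero, Nat.zero_add]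
    exact div_self (Nat.cast_ne_zero.2 (by omega))

theorem exists_layeredPerm_le_log_Upsilon {α γ : ℝ} (hα0 : 0 < α) (hα : α < 1 / 2)
    (hγ : 0 ≤ γ) (hγα : γ ≤ 4 * α) (hf : f α = γ * (1 - α ^ 2))
    (hf' : fDeriv α = -2 * γ * α) (n : ℕ) :
    ∃ b : List ℕ, (∀ c ∈ b, 0 < c) ∧ b.sum = n ∧
      γ * (n : ℝ) ^ 2 - 4 * n ≤ Real.log (Upsilon n (layeredPerm b) : ℚ) := by
  induction n using Nat.strong_induction_on with
  | _ n ih =>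
    rcases Nat.eq_zero_or_pos n with rfl | hn
    · refine ⟨[], by simp, by simp, ?_⟩
      rw [show layeredPerm [] = 1 from rfl, Upsilon_one]
      simp
    have hn' : (0 : ℝ) < n := Nat.cast_pos.2 hn
    obtain ⟨s, hs⟩ : ∃ s : ℕ, s = ⌊α * n⌋₊ := ⟨_, rfl⟩
    have hs1 : (s : ℝ) ≤ α * n := hs ▸ Nat.floor_le (by positivity)
    have hs2 : α * n < s + 1 := hs ▸ Nat.lt_floor_add_one _
    have hs3 : 2 * s + 1 ≤ n := by
      have : (2 * s : ℝ) < n := by nlinarith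
      exact_mod_cast this
    obtain ⟨c, hc⟩ : ∃ c, s + c = n := ⟨n - s, by omega⟩
    obtain ⟨b, hb, rfl, hle⟩ := ih s (by omega)
    refine ⟨b ++ [c], ?_, by rw [List.sum_append, List.sum_singleton, hc], ?_⟩
    · intro d hd
      rcases List.mem_append.1 hd with hd | hd
      · exact hb d hd
      · rw [List.mem_singleton.1 hd]
        omega
    have hsum : (b ++ [c]).sum = n := by rw [List.sum_append, List.sum_singleton, hc]
    have happ := log_Upsilon_layeredPerm_append b c
    rw [hsum] at happ
    rw [happ]
    generalize b.sum = s at *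
    rcases Nat.eq_zero_or_pos s with rfl | hs0
    · rw [layerFactor_zero_left]
      simp only [Nat.cast_zero, zero_add] at hs2 hle
      have h1 : γ * n ≤ 4 := by
        nlinarith
      have h2 : γ * (n : ℝ) ^ 2 ≤ 4 * n := by nlinarith
      simp at hle ⊢
      linarith
    · have hs0' : (0 : ℝ) < s := Nat.cast_pos.2 hs0
      have hcn : (s : ℝ) + c = n := by exact_mod_cast hc
      have h1 := layerProfile_sub_le_log_layerFactor s c
      have h2 := sum_logRatio_le_log_add hc hs3
      have h3 := three_mul_log_add_le hn
      rw [layerProfile_eq hs0'.le (Nat.cast_nonneg c) (by rw [hcn]; exact hn'), hcn] at h1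
      have hlow : γ * ((n : ℝ) ^ 2 - s ^ 2) - 2 * Real.log n ≤ (n : ℝ) ^ 2 * f (s / n) := by
        rcases hs1.eq_or_lt with he | hlt
        · have hx : (s : ℝ) / n = α := by rw [he]; field_simp
          have := Real.log_nonneg (Nat.one_le_cast.2 hn : (1 : ℝ) ≤ n)
          rw [hx, hf, he]
          nlinarith
        · have h4 := le_f_of_root hα hγ hf hf' (div_pos hs0' hn') ((div_lt_iff₀ hn').2 hlt)
          have h5 : -Real.log n ≤ Real.log (s / n) := by
            rw [Real.log_div hs0'.ne' hn'.ne']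
            have := Real.log_nonneg (Nat.one_le_cast.2 hs0 : (1 : ℝ) ≤ s)
            linarith
          have h6 : (n : ℝ) ^ 2 * (α - s / n) ^ 2 ≤ 1 := by
            rw [← mul_pow, mul_sub, mul_div_cancel₀ _ hn'.ne']
            exact pow_le_one₀ (by linarith) (by linarith)
          have h7 := mul_le_mul_of_nonneg_left h4 (sq_nonneg (n : ℝ))
          have h8 : (n : ℝ) ^ 2 * (γ * (1 - (s / n : ℝ) ^ 2)) = γ * (n ^ 2 - s ^ 2) := by
            field_simp
          have h9 := Real.log_nonneg (Nat.one_le_cast.2 hn : (1 : ℝ) ≤ n)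
          have h10 := mul_le_mul_of_nonneg_left h6 h9
          have h11 := mul_le_mul_of_nonneg_right h5
            (show 0 ≤ (n : ℝ) ^ 2 * (α - s / n) ^ 2 by positivity)
          nlinarith
      have h12 : (2 * s : ℝ) + 1 ≤ n := by exact_mod_cast hs3
      nlinarith

/-- For all `n ≥ 2`, `|log v(n) − γ n²| ≤ 4n`, where `γ = f(α)/(1−α²)` and `α` is the
unique solution in `(0,1)` of `2x·f(x) + (1−x²)·f′(x) = 0`. -/
theorem log_v_bound (α : ℝ) (hα : α ∈ Set.Ioo (0 : ℝ) 1)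
    (hroot : 2 * α * f α + (1 - α ^ 2) * deriv f α = 0)
    (huniq : ∀ β ∈ Set.Ioo (0 : ℝ) 1,
      2 * β * f β + (1 - β ^ 2) * deriv f β = 0 → β = α)
    (γ : ℝ) (hγ : γ = f α / (1 - α ^ 2)) :
    ∀ n : ℕ, 2 ≤ n → |Real.log (v n) - γ * (n : ℝ) ^ 2| ≤ 4 * n := by
  intro n _
  have hu : ∀ β ∈ Set.Ioo (0 : ℝ) 1, ratioDeriv β = 0 → β = α := by
    intro β hβ h
    refine huniq β hβ ?_
    rwa [(hasDerivAt_f hβ).deriv]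
  rw [(hasDerivAt_f hα).deriv] at hroot
  have hα2 := lt_half_of_unique hu
  have hpos : 0 < 1 - α ^ 2 := by nlinarith [hα.1, hα.2]
  have hmax : ∀ x ∈ Set.Ico (0 : ℝ) 1, f x ≤ γ * (1 - x ^ 2) := by
    rw [hγ]
    exact fun x hx => f_le_of_unique hα hu hx
  have hf : f α = γ * (1 - α ^ 2) := by rw [hγ, div_mul_cancel₀ _ hpos.ne']
  have hf' : fDeriv α = -2 * γ * α := by
    rw [hf] at hroot
    have h : (1 - α ^ 2) * (fDeriv α - -2 * γ * α) = 0 := by linear_combination hroot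
    exact sub_eq_zero.1 ((mul_eq_zero.1 h).resolve_left hpos.ne')
  have hγ0 : 0 ≤ γ := by
    have h := hmax 0 ⟨le_rfl, one_pos⟩
    rw [f_zero] at h
    linarith
  have hγα : γ ≤ 4 * α := by
    have h := f_le hα
    rw [hf] at h
    nlinarith [Real.log_two_lt_d9, hα.1]
  have hbound : ∀ w ∈ LayeredSet n, ((Upsilon n w : ℚ) : ℝ) ≤ Real.exp (γ * (n : ℝ) ^ 2) := by
    rintro _ ⟨b, hb, rfl, rfl⟩
    exact (Real.log_le_iff_le_exp (Rat.cast_pos.2 (Upsilon_layeredPerm_pos b))).1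
      (log_Upsilon_layeredPerm_le hmax b hb)
  obtain ⟨b, hb, rfl, hlow⟩ :=
    exists_layeredPerm_le_log_Upsilon hα.1 hα2 hγ0 hγα hf hf' n
  have hmem : layeredPerm b ∈ LayeredSet b.sum := ⟨b, hb, rfl, rfl⟩
  have hΥ : (0 : ℝ) < (Upsilon b.sum (layeredPerm b) : ℚ) :=
    Rat.cast_pos.2 (Upsilon_layeredPerm_pos b)
  have hle : ((Upsilon b.sum (layeredPerm b) : ℚ) : ℝ) ≤ v b.sum :=
    le_csSup ⟨_, Set.forall_mem_image.2 hbound⟩ (Set.mem_image_of_mem _ hmem)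
  have hge : v b.sum ≤ Real.exp (γ * (b.sum : ℝ) ^ 2) :=
    csSup_le (Set.image_nonempty.2 ⟨_, hmem⟩) (Set.forall_mem_image.2 hbound)
  have h1 := Real.log_le_log hΥ hle
  have h2 := (Real.log_le_iff_le_exp (hΥ.trans_le hle)).2 hge
  rw [abs_le]
  constructor <;> linarith [Nat.cast_nonneg (α := ℝ) b.sum]
end

section
/- For all integers n and m with n ≥ m ≥ 0, we have −2n ≤ log F(m, n−m) − n²·f(m/n) ≤ 0 (for n ≥ 1; for n = 0 both sides are 0). -/
/-- `F(m,p) = ∏_{1 ≤ i < j ≤ p} (2m + i + j − 1)/(i + j − 1)` (empty product is `1`). -/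
noncomputable def F (m p : ℕ) : ℝ :=
  ∏ i ∈ Finset.Icc 1 p, ∏ j ∈ Finset.Ioc i p,
    (2 * (m : ℝ) + i + j - 1) / ((i : ℝ) + j - 1)

/-- A second antiderivative of the logarithm. -/
noncomputable def logPrim (x : ℝ) : ℝ := x ^ 2 / 2 * Real.log x - 3 / 4 * x ^ 2

/-- The second central difference of `logPrim`: an average of `log` over `[s - 1, s + 1]`. -/
noncomputable def logAvg (s : ℝ) : ℝ := logPrim (s + 1) - 2 * logPrim s + logPrim (s - 1)

theorem continuous_logPrim : Continuous logPrim := by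
  have h : logPrim = fun x => x / 2 * (x * Real.log x) - 3 / 4 * x ^ 2 := by
    funext x; simp only [logPrim]; ring
  rw [h]
  have := Real.continuous_mul_log
  fun_prop

theorem hasDerivAt_logPrim {x : ℝ} (hx : 0 < x) :
    HasDerivAt logPrim (x * Real.log x - x) x := by
  have h := ((((hasDerivAt_id x).pow 2).div_const 2).mul (Real.hasDerivAt_log hx.ne')).sub
    (((hasDerivAt_id x).pow 2).const_mul (3 / 4))
  refine h.congr_deriv ?_
  simp only [id, Pi.pow_apply]
  field_simp
  ring

theorem hasDerivAt_mul_log_sub_self {x : ℝ} (hx : 0 < x) :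
    HasDerivAt (fun y => y * Real.log y - y) (Real.log x) x := by
  refine ((Real.hasDerivAt_mul_log hx.ne').sub (hasDerivAt_id x)).congr_deriv ?_
  ring

theorem exists_logAvg_eq_log {s : ℝ} (hs : 1 ≤ s) :
    ∃ η ∈ Set.Ioo (s - 1) (s + 1), logAvg s = Real.log η := by
  have hc := continuous_logPrim
  obtain ⟨ξ, ⟨hξ₁, hξ₂⟩, hξ⟩ := exists_hasDerivAt_eq_slope
    (fun x => logPrim x - logPrim (x - 1))
    (fun x => (x * Real.log x - x) - ((x - 1) * Real.log (x - 1) - (x - 1)))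
    (show s < s + 1 by linarith) (by fun_prop) (by
      rintro x ⟨hx, -⟩
      exact (hasDerivAt_logPrim (by linarith)).sub
        ((hasDerivAt_logPrim (x := x - 1) (by linarith)).comp_sub_const x 1))
  obtain ⟨η, ⟨hη₁, hη₂⟩, hη⟩ := exists_hasDerivAt_eq_slope
    (fun x => x * Real.log x - x) Real.log (show ξ - 1 < ξ by linarith)
    (by have := Real.continuous_mul_log; fun_prop)
    (fun x hx => hasDerivAt_mul_log_sub_self (by linarith [hx.1]))
  refine ⟨η, ⟨by linarith, by linarith⟩, ?_⟩
  rw [hη]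
  simp only [sub_sub_cancel, add_sub_cancel_left, add_sub_cancel_right, div_one] at hξ ⊢
  rw [hξ, logAvg]
  ring

theorem logAvg_le {s : ℝ} (hs : 1 ≤ s) : logAvg s ≤ Real.log (s + 1) := by
  obtain ⟨η, ⟨h₁, h₂⟩, h⟩ := exists_logAvg_eq_log hs
  rw [h]
  exact Real.log_le_log (by linarith) h₂.le

theorem le_logAvg {s : ℝ} (hs : 1 < s) : Real.log (s - 1) ≤ logAvg s := by
  obtain ⟨η, ⟨h₁, h₂⟩, h⟩ := exists_logAvg_eq_log hs.le
  rw [h]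
  exact Real.log_le_log (by linarith) h₁.le

theorem two_mul_le_log_sub_log {u : ℝ} (h₀ : 0 ≤ u) (h₁ : u < 1) :
    2 * u ≤ Real.log (1 + u) - Real.log (1 - u) := by
  have hu : 0 < 1 - u := by linarith
  have h := Real.le_log_one_add_of_nonneg (x := 2 * u / (1 - u)) (by positivity)
  rw [← Real.log_div (by linarith) hu.ne']
  convert h using 2
  · field_simp
    ring
  · field_simp
    ring

theorem sq_le_mul_log_add_mul_log {u : ℝ} (h₀ : 0 ≤ u) (h₁ : u < 1) :
    u ^ 2 ≤ (1 + u) * Real.log (1 + u) + (1 - u) * Real.log (1 - u) := by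
  have hd : ∀ x ∈ Set.Ico (0 : ℝ) 1, HasDerivAt
      (fun u => (1 + u) * Real.log (1 + u) + (1 - u) * Real.log (1 - u) - u ^ 2)
      (Real.log (1 + x) - Real.log (1 - x) - 2 * x) x := by
    rintro x ⟨hx₀, hx₁⟩
    have ha := (Real.hasDerivAt_mul_log (x := 1 + x) (by linarith)).comp_const_add 1 x
    have hb := (Real.hasDerivAt_mul_log (x := 1 - x) (by linarith)).comp_const_sub 1 x
    refine ((ha.add hb).sub ((hasDerivAt_id x).pow 2)).congr_deriv ?_
    simp only [id]
    ring
  have hm : MonotoneOn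
      (fun u => (1 + u) * Real.log (1 + u) + (1 - u) * Real.log (1 - u) - u ^ 2)
      (Set.Ico (0 : ℝ) 1) := by
    refine monotoneOn_of_hasDerivWithinAt_nonneg (convex_Ico 0 1)
      (fun x hx => (hd x hx).continuousAt.continuousWithinAt)
      (fun x hx => (hd x (interior_subset hx)).hasDerivWithinAt) fun x hx => ?_
    have hx' := interior_subset hx
    linarith [two_mul_le_log_sub_log hx'.1 hx'.2]
  have := hm ⟨le_rfl, one_pos⟩ ⟨h₀, h₁⟩ h₀
  simp only [add_zero, sub_zero, Real.log_one, mul_zero] at this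
  linarith

theorem one_div_le_second_difference_mul_log {s : ℝ} (hs : 1 < s) :
    1 / s ≤ (s + 1) * Real.log (s + 1) - 2 * (s * Real.log s)
      + (s - 1) * Real.log (s - 1) := by
  have hs₀ : 0 < s := by linarith
  have h := sq_le_mul_log_add_mul_log (u := 1 / s) (by positivity)
    (by rw [div_lt_one hs₀]; exact hs)
  have e₁ : 1 + 1 / s = (s + 1) / s := by field_simp
  have e₂ : 1 - 1 / s = (s - 1) / s := by field_simp
  rw [e₁, e₂, Real.log_div (by linarith) hs₀.ne', Real.log_div (by linarith) hs₀.ne'] at h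
  have h' := mul_le_mul_of_nonneg_left h hs₀.le
  have e₃ : s * (1 / s) ^ 2 = 1 / s := by field_simp
  rw [e₃] at h'
  refine h'.trans_eq ?_
  field_simp
  ring

theorem monotoneOn_logAvg_sub_log :
    MonotoneOn (fun s => logAvg s - Real.log s) (Set.Ici 1) := by
  have hc := continuous_logPrim
  refine monotoneOn_of_hasDerivWithinAt_nonneg (convex_Ici 1)
    (f' := fun s => ((s + 1) * Real.log (s + 1) - (s + 1)) - 2 * (s * Real.log s - s)
      + ((s - 1) * Real.log (s - 1) - (s - 1)) - s⁻¹) ?_ ?_ ?_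
  · refine ContinuousOn.sub (Continuous.continuousOn ?_) (Real.continuousOn_log.mono ?_)
    · unfold logAvg
      fun_prop
    · intro x hx
      exact (lt_of_lt_of_le one_pos hx).ne'
  · intro x hx
    rw [interior_Ici, Set.mem_Ioi] at hx
    exact (((((hasDerivAt_logPrim (x := x + 1) (by linarith)).comp_add_const x 1).sub
      ((hasDerivAt_logPrim (x := x) (by linarith)).const_mul 2)).add
      ((hasDerivAt_logPrim (x := x - 1) (by linarith)).comp_sub_const x 1)).sub
      (Real.hasDerivAt_log (by linarith))).hasDerivWithinAt
  · intro x hx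
    rw [interior_Ici, Set.mem_Ioi] at hx
    have := one_div_le_second_difference_mul_log hx
    rw [one_div] at this
    linarith

theorem sum_logAvg (x : ℝ) (q : ℕ) :
    ∑ i ∈ Finset.range q, logAvg (x + 1 + i) =
      logPrim (x + q + 1) - logPrim (x + q) - logPrim (x + 1) + logPrim x := by
  induction q with
  | zero => simp
  | succ q ih =>
    rw [Finset.sum_range_succ, ih, logAvg]
    push_cast
    rw [show x + 1 + (q : ℝ) - 1 = x + q by ring, show x + 1 + (q : ℝ) = x + q + 1 by ring,
      show x + ((q : ℝ) + 1) = x + q + 1 by ring]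
    ring

theorem logPrim_two_mul (x : ℝ) :
    logPrim (2 * x) = 4 * logPrim x + 2 * x ^ 2 * Real.log 2 := by
  rcases eq_or_ne x 0 with rfl | hx
  · simp [logPrim]
  · rw [logPrim, logPrim, Real.log_mul two_ne_zero hx]
    ring

/-- The value `n² f(m/n)` for `n = m + p`, written through `logPrim`. -/
noncomputable def mainTerm (m p : ℕ) : ℝ :=
  ((logPrim (2 * p + 2 * m) - 2 * logPrim (p + 2 * m) + logPrim (2 * m))
    - (logPrim (2 * p) - 2 * logPrim p)) / 2

theorem sq_mul_log_div (x y : ℝ) (hy : y ≠ 0) :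
    x ^ 2 * Real.log (x / y) = x ^ 2 * Real.log x - x ^ 2 * Real.log y := by
  rcases eq_or_ne x 0 with rfl | hx
  · simp
  · rw [Real.log_div hx hy]
    ring

theorem sq_mul_f_eq_mainTerm (m p : ℕ) :
    ((m + p : ℕ) : ℝ) ^ 2 * f ((m : ℝ) / (m + p : ℕ)) = mainTerm m p := by
  rcases Nat.eq_zero_or_pos (m + p) with h | h
  · obtain ⟨rfl, rfl⟩ : m = 0 ∧ p = 0 := by omega
    simp [mainTerm, logPrim]
  · have hn : ((m : ℝ) + p) ≠ 0 := by exact_mod_cast h.ne'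
    have h₁ : 1 - (m : ℝ) / (m + p) = p / (m + p) := by field_simp; ring
    have h₂ : 1 + (m : ℝ) / (m + p) = (p + 2 * m) / (m + p) := by field_simp; ring
    have e : ((m : ℝ) + p) ^ 2 * f ((m : ℝ) / (m + p)) =
        (m : ℝ) ^ 2 * Real.log (m / (m + p))
        - 1 / 2 * ((p : ℝ) ^ 2 * Real.log (p / (m + p)))
        - 1 / 2 * (((p : ℝ) + 2 * m) ^ 2 * Real.log ((p + 2 * m) / (m + p)))
        + 2 * m * (m + p) * Real.log 2 := by
      rw [f, h₁, h₂]
      field_simp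
    push_cast
    rw [e, sq_mul_log_div _ _ hn, sq_mul_log_div _ _ hn, sq_mul_log_div _ _ hn, mainTerm,
      show 2 * (p : ℝ) + 2 * m = 2 * (m + p) by ring, logPrim_two_mul, logPrim_two_mul,
      logPrim_two_mul]
    simp only [logPrim]
    ring

theorem mainTerm_zero_right (m : ℕ) : mainTerm m 0 = 0 := by
  simp [mainTerm, logPrim]
  ring

theorem two_mul_mainTerm_succ (m p : ℕ) :
    2 * mainTerm m (p + 1) = 2 * mainTerm m p
      + (logAvg (2 * p + 1 + 2 * m) - logAvg (2 * p + 1))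
      + 2 * ∑ i ∈ Finset.range p,
          (logAvg ((p : ℝ) + 2 * m + 1 + i) - logAvg ((p : ℝ) + 1 + i)) := by
  rw [Finset.sum_sub_distrib, sum_logAvg, sum_logAvg, logAvg, logAvg, mainTerm, mainTerm]
  push_cast
  ring_nf

theorem F_zero_right (m : ℕ) : F m 0 = 1 := by simp [F]

theorem F_succ (m p : ℕ) :
    F m (p + 1) = F m p *
      ∏ i ∈ Finset.range p, ((p : ℝ) + 2 * m + 1 + i) / ((p : ℝ) + 1 + i) := by
  have h : ∏ i ∈ Finset.range p, ((p : ℝ) + 2 * m + 1 + i) / ((p : ℝ) + 1 + i) =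
      ∏ i ∈ Finset.Icc 1 p,
        (2 * (m : ℝ) + i + (p + 1 : ℕ) - 1) / ((i : ℝ) + (p + 1 : ℕ) - 1) := by
    rw [← Finset.Ico_add_one_right_eq_Icc, Finset.prod_Ico_eq_prod_range]
    refine Finset.prod_congr rfl fun i _ => ?_
    push_cast
    congr 1 <;> ring
  rw [h, F, F, Finset.prod_Icc_succ_top (by omega), Finset.Ioc_self, Finset.prod_empty, mul_one,
    ← Finset.prod_mul_distrib]
  refine Finset.prod_congr rfl fun i hi => ?_
  rw [Finset.prod_Ioc_succ_top (Finset.mem_Icc.mp hi).2]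

theorem F_pos (m p : ℕ) : 0 < F m p := by
  induction p with
  | zero => simp [F_zero_right]
  | succ p ih =>
    rw [F_succ]
    exact mul_pos ih (Finset.prod_pos fun i _ => by positivity)

theorem log_F_succ (m p : ℕ) :
    Real.log (F m (p + 1)) = Real.log (F m p) + ∑ i ∈ Finset.range p,
      (Real.log ((p : ℝ) + 2 * m + 1 + i) - Real.log ((p : ℝ) + 1 + i)) := by
  rw [F_succ, Real.log_mul (F_pos m p).ne'
    (Finset.prod_pos fun i _ => by positivity).ne',
    Real.log_prod fun i _ => by positivity]
  congr 1
  refine Finset.sum_congr rfl fun i _ => Real.log_div ?_ ?_ <;> positivity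

theorem log_sub_log_le_logAvg_sub {s a : ℝ} (hs : 1 ≤ s) (ha : 0 ≤ a) :
    Real.log (s + a) - Real.log s ≤ logAvg (s + a) - logAvg s := by
  have := monotoneOn_logAvg_sub_log (Set.mem_Ici.mpr hs)
    (Set.mem_Ici.mpr (show 1 ≤ s + a by linarith)) (by linarith)
  dsimp only at this
  linarith

theorem log_F_le_mainTerm (m p : ℕ) : Real.log (F m p) ≤ mainTerm m p := by
  induction p with
  | zero => simp [F_zero_right, mainTerm_zero_right]
  | succ p ih =>
    have h := two_mul_mainTerm_succ m p
    rw [log_F_succ]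
    have h₁ := log_sub_log_le_logAvg_sub (s := 2 * p + 1) (a := 2 * m)
      (by linarith [p.cast_nonneg (α := ℝ)]) (by positivity)
    have h₂ : Real.log (2 * (p : ℝ) + 1) ≤ Real.log (2 * p + 1 + 2 * m) :=
      Real.log_le_log (by positivity) (by linarith [m.cast_nonneg (α := ℝ)])
    have h₃ : ∑ i ∈ Finset.range p,
        (Real.log ((p : ℝ) + 2 * m + 1 + i) - Real.log ((p : ℝ) + 1 + i)) ≤
        ∑ i ∈ Finset.range p,
          (logAvg ((p : ℝ) + 2 * m + 1 + i) - logAvg ((p : ℝ) + 1 + i)) := by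
      refine Finset.sum_le_sum fun i _ => ?_
      have := log_sub_log_le_logAvg_sub (s := (p : ℝ) + 1 + i) (a := 2 * m)
        (by linarith [p.cast_nonneg (α := ℝ), i.cast_nonneg (α := ℝ)]) (by positivity)
      rwa [show (p : ℝ) + 1 + i + 2 * m = p + 2 * m + 1 + i by ring] at this
    linarith

theorem sum_logAvg_sub_le (m p : ℕ) (hp : 1 ≤ p) :
    ∑ i ∈ Finset.range p,
      (logAvg ((p : ℝ) + 2 * m + 1 + i) - logAvg ((p : ℝ) + 1 + i)) ≤
    ∑ i ∈ Finset.range p,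
      (Real.log ((p : ℝ) + 2 * m + 1 + i) - Real.log ((p : ℝ) + 1 + i)) + 2 * Real.log 2 := by
  have hp' : (1 : ℝ) ≤ p := by exact_mod_cast hp
  have hm : (0 : ℝ) ≤ m := m.cast_nonneg
  rw [← sub_le_iff_le_add', ← Finset.sum_sub_distrib]
  calc _ ≤ ∑ i ∈ Finset.range p,
        ((Real.log ((p : ℝ) + 2 * m + 1 + (i + 1 : ℕ)) + Real.log ((p : ℝ) + (i + 1 : ℕ))) -
          (Real.log ((p : ℝ) + 2 * m + 1 + i) + Real.log ((p : ℝ) + i))) := by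
        refine Finset.sum_le_sum fun i _ => ?_
        have hi : (0 : ℝ) ≤ i := i.cast_nonneg
        have h₁ := logAvg_le (s := (p : ℝ) + 2 * m + 1 + i) (by linarith)
        have h₂ := le_logAvg (s := (p : ℝ) + 1 + i) (by linarith)
        rw [show (p : ℝ) + 1 + i - 1 = p + i by ring] at h₂
        push_cast
        rw [show (p : ℝ) + (i + 1) = p + 1 + i by ring,
          show (p : ℝ) + 2 * m + 1 + (i + 1) = p + 2 * m + 1 + i + 1 by ring]
        linarith
    _ = (Real.log ((p : ℝ) + 2 * m + 1 + p) + Real.log ((p : ℝ) + p)) -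
          (Real.log ((p : ℝ) + 2 * m + 1) + Real.log (p : ℝ)) := by
        rw [Finset.sum_range_sub (fun i : ℕ =>
          Real.log ((p : ℝ) + 2 * m + 1 + i) + Real.log ((p : ℝ) + i))]
        simp
    _ ≤ 2 * Real.log 2 := by
        have h₁ : Real.log ((p : ℝ) + 2 * m + 1 + p) ≤
            Real.log 2 + Real.log ((p : ℝ) + 2 * m + 1) := by
          rw [← Real.log_mul two_ne_zero (by positivity)]
          exact Real.log_le_log (by positivity) (by linarith)
        have h₂ : Real.log ((p : ℝ) + p) = Real.log 2 + Real.log p := by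
          rw [← Real.log_mul two_ne_zero (by positivity), two_mul]
        linarith

theorem logAvg_one : logAvg 1 = 2 * Real.log 2 - 3 / 2 := by
  norm_num [logAvg, logPrim]
  ring

theorem two_mul_mainTerm_succ_le (m q : ℕ) :
    2 * mainTerm m (q + 1) ≤ 2 * Real.log (F m (q + 1)) + (m + 1)
      + Real.log ((m + q + 1).choose q) + 4 * Real.log 2 * q := by
  have hm : (0 : ℝ) ≤ m := m.cast_nonneg
  induction q with
  | zero =>
    rw [two_mul_mainTerm_succ, log_F_succ, mainTerm_zero_right, F_zero_right]
    have h₁ := logAvg_le (s := 1 + 2 * (m : ℝ)) (by linarith)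
    rw [show 1 + 2 * (m : ℝ) + 1 = 2 * (m + 1) by ring,
      Real.log_mul two_ne_zero (by positivity)] at h₁
    have h₂ := Real.log_le_sub_one_of_pos (show (0 : ℝ) < m + 1 by positivity)
    have h₃ := Real.log_two_gt_d9
    simp [logAvg_one]
    linarith
  | succ q ih =>
    rw [two_mul_mainTerm_succ, log_F_succ]
    have hq : (0 : ℝ) ≤ q := q.cast_nonneg
    have hs := sum_logAvg_sub_le m (q + 1) (by omega)
    rw [show m + (q + 1) + 1 = m + q + 1 + 1 by ring]
    have hc : Real.log ((m + q + 1 + 1).choose (q + 1)) =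
        Real.log ((m + q + 1).choose q) + Real.log (m + q + 2) - Real.log (q + 1) := by
      have h := congrArg (Nat.cast (R := ℝ)) (Nat.add_one_mul_choose_eq (m + q + 1) q)
      push_cast at h
      have h₀ : (0 : ℝ) < (m + q + 1).choose q := by
        exact_mod_cast Nat.choose_pos (by omega)
      have h₁ : (0 : ℝ) < (m + q + 1 + 1).choose (q + 1) := by
        exact_mod_cast Nat.choose_pos (by omega)
      have h₂ := congrArg Real.log h
      rw [Real.log_mul (by positivity) h₀.ne',
        Real.log_mul h₁.ne' (by positivity)] at h₂
      rw [show (m : ℝ) + q + 1 + 1 = m + q + 2 by ring] at h₂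
      linarith
    have h₁ := logAvg_le (s := 2 * ((q + 1 : ℕ) : ℝ) + 1 + 2 * m) (by push_cast; linarith)
    have h₂ := le_logAvg (s := 2 * ((q + 1 : ℕ) : ℝ) + 1) (by push_cast; linarith)
    rw [show 2 * ((q + 1 : ℕ) : ℝ) + 1 + 2 * m + 1 = 2 * (m + q + 2) by push_cast; ring,
      Real.log_mul two_ne_zero (by positivity)] at h₁
    rw [show 2 * ((q + 1 : ℕ) : ℝ) + 1 - 1 = 2 * (q + 1) by push_cast; ring,
      Real.log_mul two_ne_zero (by positivity)] at h₂
    rw [hc]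
    have h₃ : 4 * Real.log 2 * ((q + 1 : ℕ) : ℝ) = 4 * Real.log 2 * q + 4 * Real.log 2 := by
      push_cast; ring
    linarith

theorem mainTerm_le_log_F_add (m p : ℕ) :
    mainTerm m p ≤ Real.log (F m p) + 2 * (m + p) := by
  rcases p with _ | q
  · simp [F_zero_right, mainTerm_zero_right]
  · have h := two_mul_mainTerm_succ_le m q
    have hc : Real.log ((m + q + 1).choose q) ≤ (m + q + 1) * Real.log 2 := by
      have h₀ : (0 : ℝ) < (m + q + 1).choose q := by
        exact_mod_cast Nat.choose_pos (by omega)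
      have h₁ : ((m + q + 1).choose q : ℝ) ≤ 2 ^ (m + q + 1) := by
        exact_mod_cast Nat.choose_le_two_pow _ _
      refine (Real.log_le_log h₀ h₁).trans_eq ?_
      rw [Real.log_pow]
      push_cast
      ring
    have hm : (0 : ℝ) ≤ m := m.cast_nonneg
    have hq : (0 : ℝ) ≤ q := q.cast_nonneg
    push_cast
    nlinarith [Real.log_two_lt_d9]

/-- For all integers `n ≥ m ≥ 0`: `−2n ≤ log F(m, n−m) − n² f(m/n) ≤ 0`
(for `n = 0` both sides are `0`). -/
theorem log_F_bounds (m n : ℕ) (hmn : m ≤ n) :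
    -2 * (n : ℝ) ≤ Real.log (F m (n - m)) - (n : ℝ) ^ 2 * f ((m : ℝ) / n) ∧
      Real.log (F m (n - m)) - (n : ℝ) ^ 2 * f ((m : ℝ) / n) ≤ 0 := by
  obtain ⟨p, rfl⟩ := Nat.exists_eq_add_of_le hmn
  rw [sq_mul_f_eq_mainTerm, Nat.add_sub_cancel_left]
  have h₁ := log_F_le_mainTerm m p
  have h₂ := mainTerm_le_log_F_add m p
  push_cast
  constructor <;> linarith
end
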